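/- Let u ∈ C²(closure(B₁)) with 0 ≤ u < 1 be a stable solution of −Δu = f(u) in the unit ball B₁ ⊂ ℝⁿ, where f ∈ C²([0,1)) satisfies f ≥ 0 and there exist θ > 0 and K ≥ 0 with f″(t)f(t) ≥ (1+θ)f′(t)² − K for all 0 ≤ t < 1. For every β ∈ (0, √(1+θ) − 1), setting p̄ = (2+β)·2n/(n−2) when n ≥ 3 (and p̄ ≥ 1 arbitrary when n ≤ 2), one has ‖f(u)‖_{L^{p̄}(B_{1/2})} ≤ C ‖u‖_{L¹(B₁)}, where C depends only on n, θ, K, β, and p̄. -/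

import Mathlib

open MeasureTheory Set Filter Topology Bornology Metric

/-- The Laplacian of `u : ℝⁿ → ℝ`, as the sum of second partial derivatives. -/
noncomputable def lap {n : ℕ} (u : EuclideanSpace ℝ (Fin n) → ℝ)
    (x : EuclideanSpace ℝ (Fin n)) : ℝ :=
  ∑ i, fderiv ℝ (fun y => fderiv ℝ u y (EuclideanSpace.single i 1)) x (EuclideanSpace.single i 1)

/-- `f` is of class `C²([0,1))`, with first and second derivatives `f'`, `f''`. -/
def C2On01 (f f' f'' : ℝ → ℝ) : Prop :=
  (∀ t ∈ Ico (0:ℝ) 1, HasDerivWithinAt f (f' t) (Ico (0:ℝ) 1) t) ∧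
  (∀ t ∈ Ico (0:ℝ) 1, HasDerivWithinAt f' (f'' t) (Ico (0:ℝ) 1) t) ∧
  ContinuousOn f'' (Ico (0:ℝ) 1)

/-- Stability of a solution `u` of `-Δu = f(u)` in `Ω`: nonnegativity of the second variation of
the energy on all smooth test functions compactly supported in `Ω`. Here `f'` is the derivative
of the nonlinearity. -/
def StableSol {n : ℕ} (f' : ℝ → ℝ) (u : EuclideanSpace ℝ (Fin n) → ℝ)
    (Ω : Set (EuclideanSpace ℝ (Fin n))) : Prop :=
  ∀ ξ : EuclideanSpace ℝ (Fin n) → ℝ, ContDiff ℝ (⊤:ℕ∞) ξ → HasCompactSupport ξ →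
    tsupport ξ ⊆ Ω →
    0 ≤ ∫ x in Ω, (‖gradient ξ x‖ ^ 2 - f' (u x) * ξ x ^ 2)

section Analysis

variable {E : Type*} [NormedAddCommGroup E] [NormedSpace ℝ E]

theorem ContDiffOn.mul_of_tsupport_subset {k : WithTop ℕ∞} {Ω : Set E} {a b : E → ℝ}
    (hΩ : IsOpen Ω) (ha : ContDiffOn ℝ k a Ω) (hb : ContDiff ℝ k b) (hs : tsupport b ⊆ Ω) :
    ContDiff ℝ k (fun x => a x * b x) := by
  rw [contDiff_iff_contDiffAt]
  intro x
  by_cases hx : x ∈ tsupport b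
  · exact (ha.contDiffAt (hΩ.mem_nhds (hs hx))).mul hb.contDiffAt
  · have h0 : (fun y => a y * b y) =ᶠ[𝓝 x] fun _ => 0 := by
      filter_upwards [notMem_tsupport_iff_eventuallyEq.1 hx] with y hy
      simp [hy]
    exact contDiffAt_const.congr_of_eventuallyEq h0

theorem ContinuousOn.mul_of_tsupport_subset {Ω : Set E} {a b : E → ℝ}
    (hΩ : IsOpen Ω) (ha : ContinuousOn a Ω) (hb : Continuous b) (hs : tsupport b ⊆ Ω) :
    Continuous (fun x => a x * b x) :=
  contDiff_zero.1 (ContDiffOn.mul_of_tsupport_subset hΩ (contDiffOn_zero.2 ha)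
    (contDiff_zero.2 hb) hs)

variable [MeasurableSpace E] [BorelSpace E] {μ : Measure E}

theorem ContinuousOn.integrable_mul_of_tsupport_subset [IsFiniteMeasureOnCompacts μ]
    {Ω : Set E} {a b : E → ℝ}
    (hΩ : IsOpen Ω) (ha : ContinuousOn a Ω) (hb : Continuous b) (hc : HasCompactSupport b)
    (hs : tsupport b ⊆ Ω) : Integrable (fun x => a x * b x) μ :=
  (ha.mul_of_tsupport_subset hΩ hb hs).integrable_of_hasCompactSupport hc.mul_left

theorem integral_mul_fderiv_of_tsupport_subset [FiniteDimensional ℝ E] [μ.IsAddHaarMeasure]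
    {Ω : Set E} {a b : E → ℝ} (hΩ : IsOpen Ω) (ha : ContDiffOn ℝ 1 a Ω) (hb : ContDiff ℝ 1 b)
    (hc : HasCompactSupport b) (hs : tsupport b ⊆ Ω) (v : E) :
    ∫ x, a x * fderiv ℝ b x v ∂μ = -∫ x, fderiv ℝ a x v * b x ∂μ := by
  have hbv : Continuous fun x => fderiv ℝ b x v :=
    (hb.continuous_fderiv one_ne_zero).clm_apply continuous_const
  have hav : ContinuousOn (fun x => fderiv ℝ a x v) Ω :=
    (ha.continuousOn_fderiv_of_isOpen hΩ le_rfl).clm_apply continuousOn_const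
  refine integral_mul_fderiv_eq_neg_fderiv_mul_of_integrable
    (hav.integrable_mul_of_tsupport_subset hΩ hb.continuous hc hs)
    (ha.continuousOn.integrable_mul_of_tsupport_subset hΩ hbv
      (hc.mono' ((subset_tsupport _).trans (tsupport_fderiv_apply_subset ℝ v)))
      ((tsupport_fderiv_apply_subset ℝ v).trans hs))
    (ha.continuousOn.integrable_mul_of_tsupport_subset hΩ hb.continuous hc hs)
    (fun x hx => (ha.contDiffAt (hΩ.mem_nhds (hs hx))).differentiableAt one_ne_zero)
    fun x _ => hb.differentiable one_ne_zero x

end Analysis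

section Mollification

variable {E : Type*} [NormedAddCommGroup E] [InnerProductSpace ℝ E] [FiniteDimensional ℝ E]
  [MeasurableSpace E] [BorelSpace E]

open scoped Convolution

theorem exists_contDiff_approx_C1 {ξ : E → ℝ} (hξ : ContDiff ℝ 1 ξ) (hc : HasCompactSupport ξ)
    {r r' : ℝ} (hr : r < r') (hs : tsupport ξ ⊆ closedBall 0 r) {ε : ℝ} (hε : 0 < ε) :
    ∃ ζ : E → ℝ, ContDiff ℝ (⊤ : ℕ∞) ζ ∧ HasCompactSupport ζ ∧ tsupport ζ ⊆ closedBall 0 r' ∧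
      (∀ x, |ζ x - ξ x| ≤ ε) ∧ ∀ x, ‖fderiv ℝ ζ x - fderiv ℝ ξ x‖ ≤ ε := by
  let μ : Measure E := volume
  have hdc : Continuous (fderiv ℝ ξ) := hξ.continuous_fderiv one_ne_zero
  obtain ⟨δ₁, hδ₁, h1⟩ := Metric.uniformContinuous_iff.1
    (hξ.continuous.uniformContinuous_of_tendsto_cocompact hc.is_zero_at_infty) ε hε
  obtain ⟨δ₂, hδ₂, h2⟩ := Metric.uniformContinuous_iff.1
    (hdc.uniformContinuous_of_tendsto_cocompact (hc.fderiv ℝ).is_zero_at_infty) ε hε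
  set δ := min (min δ₁ δ₂) (r' - r) with hδ
  have hδ0 : 0 < δ := lt_min (lt_min hδ₁ hδ₂) (sub_pos.2 hr)
  let φ : ContDiffBump (0 : E) := ⟨δ / 2, δ, half_pos hδ0, half_lt_self hδ0⟩
  have hφs : φ.rOut = δ := rfl
  have hφ1 : ContDiff ℝ (⊤ : ℕ∞) (φ.normed μ) := φ.contDiff_normed
  have hφc : HasCompactSupport (φ.normed μ) := φ.hasCompactSupport_normed
  let L := ContinuousLinearMap.lsmul ℝ ℝ (E := ℝ)
  have hsupp : tsupport (φ.normed μ ⋆[L, μ] ξ) ⊆ closedBall 0 r' := by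
    refine closure_minimal ?_ isClosed_closedBall
    refine (support_convolution_subset L).trans ?_
    rintro _ ⟨a, ha, b, hb, rfl⟩
    rw [φ.support_normed_eq, hφs, mem_ball_zero_iff] at ha
    have hb' := mem_closedBall_zero_iff.1 (hs (subset_tsupport _ hb))
    rw [mem_closedBall_zero_iff]
    have : δ ≤ r' - r := min_le_right _ _
    exact (norm_add_le _ _).trans (by linarith)
  refine ⟨φ.normed μ ⋆[L, μ] ξ, ?_, ?_, hsupp, fun x => ?_, fun x => ?_⟩
  · exact hφc.contDiff_convolution_left L hφ1 hξ.continuous.locallyIntegrable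
  · exact HasCompactSupport.of_support_subset_isCompact (isCompact_closedBall 0 r')
      ((subset_tsupport _).trans hsupp)
  · rw [← Real.dist_eq]
    refine φ.dist_normed_convolution_le hξ.continuous.aestronglyMeasurable fun y hy => (h1 ?_).le
    exact hy.trans_le ((min_le_left _ _).trans (min_le_left _ _))
  · have hd := (hc.hasFDerivAt_convolution_right L (μ := μ)
      (hφ1.continuous.locallyIntegrable) hξ x).fderiv
    have he : (φ.normed μ ⋆[L.precompR E, μ] fderiv ℝ ξ) x =
        (φ.normed μ ⋆[ContinuousLinearMap.lsmul ℝ ℝ, μ] fderiv ℝ ξ) x := by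
      unfold convolution
      congr 1
    rw [hd, he, ← dist_eq_norm]
    refine φ.dist_normed_convolution_le hdc.aestronglyMeasurable fun y hy => (h2 ?_).le
    exact hy.trans_le ((min_le_left _ _).trans (min_le_right _ _))

end Mollification

section Stability

variable {n : ℕ}

local notation "E" => EuclideanSpace ℝ (Fin n)

theorem norm_gradient_eq_norm_fderiv (w : E → ℝ) (x : E) : ‖gradient w x‖ = ‖fderiv ℝ w x‖ := by
  rw [← toDual_gradient, LinearIsometryEquiv.norm_map]

theorem StableSol.of_contDiff_one {f' : ℝ → ℝ} {u : E → ℝ}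
    (hf' : ContinuousOn (fun x => f' (u x)) (ball 0 1)) (h : StableSol f' u (ball 0 1))
    {ξ : E → ℝ} (hξ : ContDiff ℝ 1 ξ) {r : ℝ} (hr : r < 1) (hs : tsupport ξ ⊆ closedBall 0 r) :
    0 ≤ ∫ x, (‖gradient ξ x‖ ^ 2 - f' (u x) * ξ x ^ 2) := by
  have hc : HasCompactSupport ξ := HasCompactSupport.of_support_subset_isCompact
    (isCompact_closedBall 0 r) ((subset_tsupport _).trans hs)
  obtain ⟨r', hr', hr'1⟩ := exists_between hr
  have hB : closedBall (0 : E) r' ⊆ ball 0 1 := closedBall_subset_ball hr'1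
  have hex : ∀ k : ℕ, ∃ ζ : E → ℝ, ContDiff ℝ (⊤ : ℕ∞) ζ ∧ HasCompactSupport ζ ∧
      tsupport ζ ⊆ closedBall 0 r' ∧ (∀ x, |ζ x - ξ x| ≤ 1 / ((k : ℝ) + 1)) ∧
      ∀ x, ‖fderiv ℝ ζ x - fderiv ℝ ξ x‖ ≤ 1 / ((k : ℝ) + 1) := fun k =>
    exists_contDiff_approx_C1 hξ hc hr' hs (by positivity)
  choose ζ hζ hζc hζs hζ0 hζ1 using hex
  have hz : ∀ {ψ : E → ℝ}, tsupport ψ ⊆ closedBall 0 r' → ∀ x, x ∉ closedBall (0 : E) r' →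
      ‖gradient ψ x‖ ^ 2 - f' (u x) * ψ x ^ 2 = 0 := by
    intro ψ hψ x hx
    have hx' : x ∉ tsupport ψ := fun h => hx (hψ h)
    have h2 : fderiv ℝ ψ x = 0 := by
      by_contra hne
      exact hx' (tsupport_fderiv_subset ℝ (subset_tsupport _ hne))
    rw [norm_gradient_eq_norm_fderiv, h2, image_eq_zero_of_notMem_tsupport hx']
    simp
  have hlim0 : Tendsto (fun k : ℕ => 1 / ((k : ℝ) + 1)) atTop (𝓝 0) :=
    tendsto_one_div_add_atTop_nhds_zero_nat
  have ht0 : ∀ x, Tendsto (fun k => ζ k x) atTop (𝓝 (ξ x)) := fun x =>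
    tendsto_iff_norm_sub_tendsto_zero.2 (squeeze_zero (fun _ => norm_nonneg _)
      (fun k => by simpa using hζ0 k x) hlim0)
  have ht1 : ∀ x, Tendsto (fun k => fderiv ℝ (ζ k) x) atTop (𝓝 (fderiv ℝ ξ x)) := fun x =>
    tendsto_iff_norm_sub_tendsto_zero.2 (squeeze_zero (fun _ => norm_nonneg _)
      (fun k => hζ1 k x) hlim0)
  obtain ⟨M0, hM0⟩ := hξ.continuous.bounded_above_of_compact_support hc
  obtain ⟨M1, hM1⟩ := (hξ.continuous_fderiv one_ne_zero).bounded_above_of_compact_support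
    (hc.fderiv ℝ)
  obtain ⟨M2, hM2⟩ := (isCompact_closedBall (0 : E) r').exists_bound_of_continuousOn (hf'.mono hB)
  have key : Tendsto (fun k => ∫ x in closedBall (0 : E) r',
      (‖gradient (ζ k) x‖ ^ 2 - f' (u x) * ζ k x ^ 2)) atTop
      (𝓝 (∫ x in closedBall (0 : E) r', (‖gradient ξ x‖ ^ 2 - f' (u x) * ξ x ^ 2))) := by
    refine tendsto_integral_of_dominated_convergence
      (fun _ => (M1 + 1) ^ 2 + M2 * (M0 + 1) ^ 2) (fun k => ?_) ?_ (fun k => ?_) ?_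
    · refine ContinuousOn.aestronglyMeasurable ?_ isClosed_closedBall.measurableSet
      simp only [norm_gradient_eq_norm_fderiv]
      have h1 := ((hζ k).continuous_fderiv (by simp)).continuousOn (s := closedBall (0 : E) r')
      exact (h1.norm.pow 2).sub ((hf'.mono hB).mul ((hζ k).continuous.continuousOn.pow 2))
    · exact integrableOn_const (isCompact_closedBall _ _).measure_lt_top.ne
    · refine (ae_restrict_iff' isClosed_closedBall.measurableSet).2 (Eventually.of_forall ?_)
      intro x hx
      have hk : 1 / ((k : ℝ) + 1) ≤ 1 := by
        rw [div_le_one (by positivity)]; linarith [Nat.cast_nonneg (α := ℝ) k]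
      have e1 : ‖fderiv ℝ (ζ k) x‖ ≤ M1 + 1 := by
        have := norm_sub_norm_le (fderiv ℝ (ζ k) x) (fderiv ℝ ξ x)
        linarith [hζ1 k x, hM1 x]
      have e0 : |ζ k x| ≤ M0 + 1 := by
        have := norm_sub_norm_le (ζ k x) (ξ x)
        simp only [Real.norm_eq_abs] at this
        linarith [hζ0 k x, hM0 x, Real.norm_eq_abs (ξ x)]
      have e2 := hM2 x hx
      rw [norm_gradient_eq_norm_fderiv]
      refine (norm_sub_le _ _).trans ?_
      rw [norm_mul, norm_pow, norm_pow, norm_norm, Real.norm_eq_abs (ζ k x)]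
      gcongr
      exact (norm_nonneg _).trans e2
    · refine Eventually.of_forall fun x => ?_
      simp only [norm_gradient_eq_norm_fderiv]
      exact ((ht1 x).norm.pow 2).sub (((ht0 x).pow 2).const_mul _)
  rw [setIntegral_eq_integral_of_forall_compl_eq_zero
    (hz (hs.trans (closedBall_subset_closedBall hr'.le)))] at key
  refine ge_of_tendsto' key fun k => ?_
  rw [setIntegral_eq_integral_of_forall_compl_eq_zero (hz (hζs k)),
    ← setIntegral_eq_integral_of_forall_compl_eq_zero (s := ball (0 : E) 1)
      fun x hx => hz (hζs k) x fun h => hx (hB h)]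
  exact h (ζ k) (hζ k) (hζc k) ((hζs k).trans hB)

theorem integral_inner_gradient_eq {Ω : Set E} (hΩ : IsOpen Ω) {u φ : E → ℝ}
    (hu : ContDiffOn ℝ 2 u Ω) (hφ : ContDiff ℝ 1 φ) (hc : HasCompactSupport φ)
    (hs : tsupport φ ⊆ Ω) :
    ∫ x, inner ℝ (gradient u x) (gradient φ x) = ∫ x, -lap u x * φ x := by
  have hu1 : ∀ v : E, ContDiffOn ℝ 1 (fun x => fderiv ℝ u x v) Ω := fun v =>
    (hu.fderiv_of_isOpen hΩ (by norm_num)).clm_apply contDiffOn_const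
  have hco : ∀ (w : E → ℝ) (x : E) (i : Fin n),
      gradient w x i = fderiv ℝ w x (EuclideanSpace.single i 1) := by
    intro w x i
    rw [← inner_gradient_left, EuclideanSpace.inner_single_right]
    simp
  have hI1 : ∀ i : Fin n, Integrable fun x => fderiv ℝ u x (EuclideanSpace.single i 1) *
      fderiv ℝ φ x (EuclideanSpace.single i 1) := fun i =>
    (hu1 _).continuousOn.integrable_mul_of_tsupport_subset hΩ
      ((hφ.continuous_fderiv one_ne_zero).clm_apply continuous_const)
      (hc.mono' ((subset_tsupport _).trans (tsupport_fderiv_apply_subset ℝ _)))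
      ((tsupport_fderiv_apply_subset ℝ _).trans hs)
  have hI2 : ∀ i : Fin n, Integrable fun x =>
      fderiv ℝ (fun y => fderiv ℝ u y (EuclideanSpace.single i 1)) x
        (EuclideanSpace.single i 1) * φ x := fun i =>
    (((hu1 _).continuousOn_fderiv_of_isOpen hΩ le_rfl).clm_apply
      continuousOn_const).integrable_mul_of_tsupport_subset hΩ hφ.continuous hc hs
  have h1 : ∀ x, inner ℝ (gradient u x) (gradient φ x) =
      ∑ i, fderiv ℝ u x (EuclideanSpace.single i 1) * fderiv ℝ φ x (EuclideanSpace.single i 1) := by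
    intro x
    rw [PiLp.inner_apply]
    refine Finset.sum_congr rfl fun i _ => ?_
    rw [hco, hco, real_inner_comm, RCLike.inner_apply, conj_trivial]
  simp_rw [h1, lap, neg_mul, Finset.sum_mul]
  rw [integral_neg, integral_finsetSum _ fun i _ => hI1 i, integral_finsetSum _ fun i _ => hI2 i,
    ← Finset.sum_neg_distrib]
  exact Finset.sum_congr rfl fun i _ =>
    integral_mul_fderiv_of_tsupport_subset hΩ (hu1 _) hφ hc hs _

theorem integral_neg_lap_mul_eq {Ω : Set E} (hΩ : IsOpen Ω) {u φ : E → ℝ}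
    (hu : ContDiffOn ℝ 2 u Ω) (hφ : ContDiff ℝ 2 φ) (hc : HasCompactSupport φ)
    (hs : tsupport φ ⊆ Ω) :
    ∫ x, -lap u x * φ x = ∫ x, u x * -lap φ x := by
  have hu1 : ContDiffOn ℝ 1 u Ω := hu.of_le (by norm_num)
  have hφ1 : ∀ v : E, ContDiff ℝ 1 (fun x => fderiv ℝ φ x v) := fun v =>
    (hφ.fderiv_right (by norm_num)).clm_apply contDiff_const
  have hI : ∀ i : Fin n, Integrable fun x => u x *
      fderiv ℝ (fun y => fderiv ℝ φ y (EuclideanSpace.single i 1)) x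
        (EuclideanSpace.single i 1) := fun i =>
    hu.continuousOn.integrable_mul_of_tsupport_subset hΩ
      (((hφ1 _).continuous_fderiv one_ne_zero).clm_apply continuous_const)
      (hc.mono' ((subset_tsupport _).trans ((tsupport_fderiv_apply_subset ℝ _).trans
        (tsupport_fderiv_apply_subset ℝ _))))
      (((tsupport_fderiv_apply_subset ℝ _).trans (tsupport_fderiv_apply_subset ℝ _)).trans hs)
  have hu2 : ∀ v : E, ContDiffOn ℝ 1 (fun x => fderiv ℝ u x v) Ω := fun v =>
    (hu.fderiv_of_isOpen hΩ (by norm_num)).clm_apply contDiffOn_const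
  have hI2 : ∀ i : Fin n, Integrable fun x =>
      fderiv ℝ (fun y => fderiv ℝ u y (EuclideanSpace.single i 1)) x
        (EuclideanSpace.single i 1) * φ x := fun i =>
    (((hu2 _).continuousOn_fderiv_of_isOpen hΩ le_rfl).clm_apply
      continuousOn_const).integrable_mul_of_tsupport_subset hΩ hφ.continuous hc hs
  simp_rw [lap, neg_mul, mul_neg, Finset.sum_mul, Finset.mul_sum]
  rw [integral_neg, integral_neg, integral_finsetSum _ fun i _ => hI i,
    integral_finsetSum _ fun i _ => hI2 i]
  congr 1
  refine Finset.sum_congr rfl fun i _ => ?_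
  have h1 := integral_mul_fderiv_of_tsupport_subset (μ := volume) hΩ hu1
    (hφ1 (EuclideanSpace.single i 1))
    (hc.mono' ((subset_tsupport _).trans (tsupport_fderiv_apply_subset ℝ _)))
    ((tsupport_fderiv_apply_subset ℝ _).trans hs) (EuclideanSpace.single i 1)
  have h2 := integral_mul_fderiv_of_tsupport_subset (μ := volume) hΩ
    (hu2 (EuclideanSpace.single i 1)) (hφ.of_le (by norm_num)) hc hs (EuclideanSpace.single i 1)
  rw [h1, h2, neg_neg]

end Stability

section Pointwise

theorem mul_rpow_le_of_scaled {β τ F u : ℝ} (hβ : 0 < β) (hτ : 0 < τ) (hF : 0 ≤ F) (hu : 0 ≤ u) :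
    u ^ 2 * (F ^ β) ^ 2 ≤
      τ ^ 2 * ((F ^ β) ^ 2 * F ^ 2) + ((τ⁻¹) ^ β) ^ 2 * ((u ^ β) ^ 2 * u ^ 2) := by
  rcases le_total u (τ * F) with h | h
  · have h1 : u ^ 2 ≤ (τ * F) ^ 2 := by gcongr
    have h2 : u ^ 2 * (F ^ β) ^ 2 ≤ (τ * F) ^ 2 * (F ^ β) ^ 2 := by gcongr
    have h3 : 0 ≤ ((τ⁻¹) ^ β) ^ 2 * ((u ^ β) ^ 2 * u ^ 2) := by positivity
    nlinarith
  · have h1 : F ≤ τ⁻¹ * u := by rw [inv_mul_eq_div, le_div_iff₀ hτ]; linarith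
    have h2 : F ^ β ≤ (τ⁻¹) ^ β * u ^ β := by
      rw [← Real.mul_rpow (by positivity) hu]
      gcongr
    have h3 : u ^ 2 * (F ^ β) ^ 2 ≤ u ^ 2 * ((τ⁻¹) ^ β * u ^ β) ^ 2 := by gcongr
    have h4 : 0 ≤ τ ^ 2 * ((F ^ β) ^ 2 * F ^ 2) := by positivity
    nlinarith

set_option maxHeartbeats 1000000 in
/-- Algebraic core of the energy estimate: a combination of the integrands of the stability
inequality and of the equation tested against `f'(u) f(u)^(2s-1) η²`, `u f(u)^(2s-2) η²` and
`u^(2s-1) η²`, with `s = 2 + β`, `X = f(u)^β`, `Y = u^β`. -/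
theorem exists_pointwise_energy_bound {θ K β : ℝ} (hθ : 0 < θ) (hK : 0 ≤ K) (hβ : 0 < β)
    (hβ' : β < Real.sqrt (1 + θ) - 1) :
    ∃ a b c C : ℝ, 0 < c ∧ 0 ≤ C ∧ ∀ F D D₂ u e p q r X Y : ℝ, 0 ≤ F → 0 ≤ u → 0 ≤ p → 0 ≤ q →
      X = F ^ β → Y = u ^ β →
      (∀ δ : ℝ, 0 < δ → ∀ x y : ℝ, 2 * (x * y * r) ≤ δ * x ^ 2 * p + δ⁻¹ * y ^ 2 * q) →
      (1 + θ) * D ^ 2 - K ≤ D₂ * F →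
      (((2 + β) * (D * (X * F)) * e) ^ 2 * p + 2 * ((2 + β) * (D * (X * F)) * e * (X * F ^ 2) * r)
          + (X * F ^ 2) ^ 2 * q - D * ((X * F ^ 2) * e) ^ 2)
        - ((D₂ * (X ^ 2 * F ^ 3) + D * ((3 + 2 * β) * D * (X ^ 2 * F ^ 2))) * p * e ^ 2
          + 2 * (D * (X ^ 2 * F ^ 3)) * e * r - F * (D * (X ^ 2 * F ^ 3)) * e ^ 2)
        - a * ((X ^ 2 * F ^ 2 + u * ((2 + 2 * β) * D * (X ^ 2 * F))) * p * e ^ 2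
          + 2 * (u * (X ^ 2 * F ^ 2)) * e * r - F * (u * (X ^ 2 * F ^ 2)) * e ^ 2)
        - b * ((3 + 2 * β) * (Y ^ 2 * u ^ 2) * p * e ^ 2
          + 2 * (Y ^ 2 * u ^ 3) * e * r - F * (Y ^ 2 * u ^ 3) * e ^ 2) ≤
      -c * ((D * (X * F)) ^ 2 + (Y * u) ^ 2) * p * e ^ 2
        + C * ((X * F ^ 2) ^ 2 + (Y * u ^ 2) ^ 2) * (e ^ 2 + q) := by
  set κ : ℝ := 1 + θ - (1 + β) ^ 2 with hκ
  have hκ0 : 0 < κ := by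
    have h1 : 1 + β < Real.sqrt (1 + θ) := by linarith
    have h2 := Real.sq_sqrt (show (0 : ℝ) ≤ 1 + θ by linarith)
    nlinarith
  set a : ℝ := K + 2 with ha
  set C₁ : ℝ := (a * (2 + 2 * β)) ^ 2 / κ with hC₁
  have hC₁0 : 0 ≤ C₁ := by positivity
  set τ : ℝ := (1 + C₁)⁻¹ with hτ
  have hτ0 : 0 < τ := by positivity
  have hτ1 : C₁ * τ ^ 2 ≤ 1 := by
    have : τ * (1 + C₁) = 1 := inv_mul_cancel₀ (by positivity)
    have h1 : τ ≤ 1 := by linarith [mul_nonneg hC₁0 hτ0.le]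
    calc C₁ * τ ^ 2 = (1 - τ) * τ := by linear_combination τ * this
      _ ≤ 1 * 1 := by gcongr; linarith
      _ = 1 := one_mul 1
  set Cτ : ℝ := ((τ⁻¹) ^ β) ^ 2 with hCτ
  have hCτ0 : 0 ≤ Cτ := by positivity
  set b : ℝ := C₁ * Cτ + 1 with hb
  have hb1 : 1 ≤ b := by have := mul_nonneg hC₁0 hCτ0; linarith
  refine ⟨a, b, min (κ / 2) 1, 4 / κ * (1 + β) ^ 2 + 1 + 2 * a ^ 2 + a + 2 * b, by positivity,
    by positivity, ?_⟩
  intro F D D₂ u e p q r X Y hF hu hp hq hX hY hr hD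
  have hX0 : 0 ≤ X := hX ▸ Real.rpow_nonneg hF β
  have hY0 : 0 ≤ Y := hY ▸ Real.rpow_nonneg hu β
  set V := X * F ^ 2 with hV
  set W := Y * u ^ 2 with hW
  have hV0 : 0 ≤ V := by positivity
  have hW0 : 0 ≤ W := by positivity
  have hXY : F ≤ u → X ≤ Y := fun h => by rw [hX, hY]; gcongr
  have hYX : u ≤ F → Y ≤ X := fun h => by rw [hX, hY]; gcongr
  have m1 : u * (X * F) ≤ V + W := by
    rcases le_total u F with h | h
    · have h1 : u * (X * F) ≤ F * (X * F) := by gcongr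
      have h2 : F * (X * F) = V := by rw [hV]; ring
      linarith
    · have h1 : u * (X * F) ≤ u * (Y * u) := by gcongr; exact hXY h
      have h2 : u * (Y * u) = W := by rw [hW]; ring
      linarith
  have m2 : F * (u * (X ^ 2 * F ^ 2)) ≤ V ^ 2 + W ^ 2 := by
    rcases le_total u F with h | h
    · have h1 : F * (u * (X ^ 2 * F ^ 2)) ≤ F * (F * (X ^ 2 * F ^ 2)) := by gcongr
      have h2 : F * (F * (X ^ 2 * F ^ 2)) = V ^ 2 := by rw [hV]; ring
      linarith [sq_nonneg W]
    · have h1 : F * (u * (X ^ 2 * F ^ 2)) ≤ u * (u * (Y ^ 2 * u ^ 2)) := by gcongr; exact hXY h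
      have h2 : u * (u * (Y ^ 2 * u ^ 2)) = W ^ 2 := by rw [hW]; ring
      linarith [sq_nonneg V]
  have m3 : F * (Y ^ 2 * u ^ 3) ≤ V ^ 2 + W ^ 2 := by
    rcases le_total u F with h | h
    · have h1 : F * (Y ^ 2 * u ^ 3) ≤ F * (X ^ 2 * F ^ 3) := by gcongr; exact hYX h
      have h2 : F * (X ^ 2 * F ^ 3) = V ^ 2 := by rw [hV]; ring
      linarith [sq_nonneg W]
    · have h1 : F * (Y ^ 2 * u ^ 3) ≤ u * (Y ^ 2 * u ^ 3) := by gcongr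
      have h2 : u * (Y ^ 2 * u ^ 3) = W ^ 2 := by rw [hW]; ring
      linarith [sq_nonneg V]
  have t0 : X ^ 2 * F ^ 2 * ((1 + θ) * D ^ 2 - K) * (p * e ^ 2) ≤
      X ^ 2 * F ^ 2 * (D₂ * F) * (p * e ^ 2) := by gcongr
  have t1 := hr (κ / 4) (by positivity) (D * (X * F) * e) ((1 + β) * V)
  have t2 : -(a * (2 + 2 * β)) * ((D * (X * F) * e) * (u * X * e)) ≤
      κ / 4 * (D * (X * F) * e) ^ 2 + C₁ * (u * X * e) ^ 2 := by
    have h1 : C₁ * κ = (a * (2 + 2 * β)) ^ 2 := div_mul_cancel₀ _ hκ0.ne'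
    generalize D * (X * F) * e = x
    generalize u * X * e = y
    have h2 : 0 ≤ (κ / 2 * x + (a * (2 + 2 * β)) * y) ^ 2 := sq_nonneg _
    have h3 : C₁ * κ * y ^ 2 = (a * (2 + 2 * β)) ^ 2 * y ^ 2 := by rw [h1]
    refine le_of_mul_le_mul_left ?_ hκ0
    linarith
  have t2' := mul_le_mul_of_nonneg_right t2 hp
  have t3 : u ^ 2 * X ^ 2 ≤ τ ^ 2 * (X ^ 2 * F ^ 2) + Cτ * (Y ^ 2 * u ^ 2) := by
    have := mul_rpow_le_of_scaled hβ hτ0 hF hu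
    rwa [← hX, ← hY] at this
  have t4 : C₁ * (u * X * e) ^ 2 * p ≤
      (X ^ 2 * F ^ 2 + (b - 1) * (Y ^ 2 * u ^ 2)) * (p * e ^ 2) := by
    have h1 : C₁ * (u ^ 2 * X ^ 2) ≤ X ^ 2 * F ^ 2 + (b - 1) * (Y ^ 2 * u ^ 2) := by
      have h2 := mul_le_mul_of_nonneg_left t3 hC₁0
      have h3 : C₁ * τ ^ 2 * (X ^ 2 * F ^ 2) ≤ 1 * (X ^ 2 * F ^ 2) := by gcongr
      rw [hb]
      linarith
    have h2 : 0 ≤ p * e ^ 2 := by positivity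
    have h3 := mul_le_mul_of_nonneg_right h1 h2
    linarith
  have t5 := hr 1 one_pos (-(X * F * e)) (a * (u * (X * F)))
  have t6 : (u * (X * F)) ^ 2 ≤ 2 * (V ^ 2 + W ^ 2) := by
    have h1 : (u * (X * F)) ^ 2 ≤ (V + W) ^ 2 := by gcongr
    linarith [sq_nonneg (V - W)]
  have t6' : a ^ 2 * (u * (X * F)) ^ 2 * q ≤ a ^ 2 * (2 * (V ^ 2 + W ^ 2)) * q := by gcongr
  have t7 : a * (F * (u * (X ^ 2 * F ^ 2))) * e ^ 2 ≤ a * (V ^ 2 + W ^ 2) * e ^ 2 := by gcongr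
  have t8 := hr 1 one_pos (-(Y * u * e)) W
  have t8' := mul_le_mul_of_nonneg_left t8 (zero_le_one.trans hb1)
  have t9 : b * (F * (Y ^ 2 * u ^ 3)) * e ^ 2 ≤ b * (V ^ 2 + W ^ 2) * e ^ 2 := by gcongr
  have hdd : 0 ≤ (Y * u) ^ 2 * (p * e ^ 2) := by positivity
  have t10 : 3 * (b * ((Y * u) ^ 2 * (p * e ^ 2))) ≤
      (3 + 2 * β) * (b * ((Y * u) ^ 2 * (p * e ^ 2))) := by
    gcongr
    linarith
  have hinv : (κ / 4)⁻¹ = 4 / κ := by rw [inv_div]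
  have hA0 : 0 ≤ (D * (X * F)) ^ 2 * (p * e ^ 2) := by positivity
  have c1 : min (κ / 2) 1 * ((D * (X * F)) ^ 2 * (p * e ^ 2)) ≤
      κ / 2 * ((D * (X * F)) ^ 2 * (p * e ^ 2)) := by gcongr; exact min_le_left _ _
  have c2 : min (κ / 2) 1 * ((Y * u) ^ 2 * (p * e ^ 2)) ≤ 1 * ((Y * u) ^ 2 * (p * e ^ 2)) := by
    gcongr; exact min_le_right _ _
  have c3 : 0 ≤ b * ((Y * u) ^ 2 * (p * e ^ 2)) := by positivity
  set S := V ^ 2 + W ^ 2 with hS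
  have hS0 : 0 ≤ S := by positivity
  have d1 : 4 / κ * (1 + β) ^ 2 * V ^ 2 * q ≤ 4 / κ * (1 + β) ^ 2 * S * q := by
    gcongr; rw [hS]; linarith [sq_nonneg W]
  have d2 : V ^ 2 * q ≤ S * q := by gcongr; rw [hS]; linarith [sq_nonneg W]
  have d3 : b * (W ^ 2 * q) ≤ b * (S * q) := by gcongr; rw [hS]; linarith [sq_nonneg V]
  have r1 : 0 ≤ 4 / κ * (1 + β) ^ 2 * (S * e ^ 2) := by positivity
  have r2 : 0 ≤ S * e ^ 2 := by positivity
  have r3 : 0 ≤ a ^ 2 * (S * e ^ 2) := by positivity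
  have r4 : 0 ≤ a * (S * q) := by positivity
  have r5 : 0 ≤ b * (S * q) := by positivity
  have r6 : 0 ≤ b * (S * e ^ 2) := by positivity
  rw [hinv] at t1
  rw [inv_one] at t5 t8'
  have hκe : θ = κ - 1 + (1 + β) ^ 2 := by rw [hκ]; ring
  have hKa : K = a - 2 := by rw [ha]; ring
  rw [hκe, hKa] at t0
  clear_value κ a b C₁ τ Cτ S V W
  subst hS hW hV
  linear_combination t0 + t1 + t2' + t4 + t5 + t6' + t7 + t8' + t9 + t10 + c1 + c2 + c3 + d1 + d2 +
    d3 + r1 + r2 + 2 * r3 + r4 + r5 + r6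

end Pointwise

section Energy

variable {n : ℕ}

local notation "E" => EuclideanSpace ℝ (Fin n)

theorem HasDerivWithinAt.comp_hasGradientAt {G G' : ℝ → ℝ} {I : Set ℝ} {u : E → ℝ} {Ω : Set E}
    (hG : ∀ t ∈ I, HasDerivWithinAt G (G' t) I t) (hΩ : IsOpen Ω) (hI : MapsTo u Ω I) {x : E}
    (hx : x ∈ Ω) (hu : DifferentiableAt ℝ u x) :
    HasGradientAt (fun y => G (u y)) (G' (u x) • gradient u x) x := by
  rw [hasGradientAt_iff_hasFDerivAt, map_smul, toDual_gradient]
  exact ((hG (u x) (hI hx)).comp_hasFDerivWithinAt x hu.hasFDerivAt.hasFDerivWithinAt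
    hI).hasFDerivAt (hΩ.mem_nhds hx)

theorem contDiffOn_one_of_hasDerivWithinAt {G G' : ℝ → ℝ} {I : Set ℝ} (hI : UniqueDiffOn ℝ I)
    (hG : ∀ t ∈ I, HasDerivWithinAt G (G' t) I t) (hG' : ContinuousOn G' I) :
    ContDiffOn ℝ 1 G I :=
  (contDiffOn_one_iff_derivWithin hI).2 ⟨fun t ht => (hG t ht).differentiableWithinAt,
    hG'.congr fun t ht => (hG t ht).derivWithin (hI t ht)⟩

theorem HasGradientAt.mul' {a b : E → ℝ} {a' b' x : E} (ha : HasGradientAt a a' x)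
    (hb : HasGradientAt b b' x) :
    HasGradientAt (fun y => a y * b y) (b x • a' + a x • b') x := by
  rw [hasGradientAt_iff_hasFDerivAt] at *
  rw [map_add, map_smul, map_smul, add_comm]
  exact ha.mul hb

theorem integrable_of_continuousOn_of_eq_zero {Ω S : Set E} {F : E → ℝ} (hS : IsCompact S)
    (hSΩ : S ⊆ Ω) (hF : ContinuousOn F Ω) (h0 : ∀ x, x ∉ S → F x = 0) : Integrable F :=
  ((hF.mono hSΩ).integrableOn_compact hS).integrable_of_forall_notMem_eq_zero h0

theorem gradient_eq_zero_of_notMem_tsupport {w : E → ℝ} {x : E} (hx : x ∉ tsupport w) :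
    gradient w x = 0 := by
  rw [← norm_eq_zero, norm_gradient_eq_norm_fderiv, norm_eq_zero]
  by_contra hne
  exact hx (tsupport_fderiv_subset ℝ (subset_tsupport _ hne))

theorem ContDiffOn.continuousOn_gradient {w : E → ℝ} {Ω : Set E} {k : WithTop ℕ∞}
    (hΩ : IsOpen Ω) (hw : ContDiffOn ℝ k w Ω) (hk : 1 ≤ k) : ContinuousOn (gradient w) Ω :=
  (InnerProductSpace.toDual ℝ E).symm.continuous.comp_continuousOn
    (hw.continuousOn_fderiv_of_isOpen hΩ hk)

theorem integral_test_function_eq {f G G' : ℝ → ℝ} {u η : E → ℝ} {Ω : Set E}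
    (hΩ : IsOpen Ω) (hf : ContinuousOn f (Ico 0 1))
    (hu : ContDiffOn ℝ 2 u Ω) (hI : MapsTo u Ω (Ico 0 1)) (heq : ∀ x ∈ Ω, -lap u x = f (u x))
    (hG : ∀ t ∈ Ico (0 : ℝ) 1, HasDerivWithinAt G (G' t) (Ico 0 1) t)
    (hG' : ContinuousOn G' (Ico 0 1)) (hη : ContDiff ℝ 1 η) (hc : HasCompactSupport η)
    (hs : tsupport η ⊆ Ω) :
    Integrable (fun x => G' (u x) * ‖gradient u x‖ ^ 2 * η x ^ 2 +
      2 * G (u x) * η x * inner ℝ (gradient u x) (gradient η x) - f (u x) * G (u x) * η x ^ 2) ∧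
    ∫ x, (G' (u x) * ‖gradient u x‖ ^ 2 * η x ^ 2 +
      2 * G (u x) * η x * inner ℝ (gradient u x) (gradient η x) -
        f (u x) * G (u x) * η x ^ 2) = 0 := by
  have hGc : ContinuousOn G (Ico 0 1) := fun t ht => (hG t ht).continuousWithinAt
  have cu := hu.continuousOn
  have cf : ContinuousOn (fun x => f (u x)) Ω := hf.comp cu hI
  have cG : ContinuousOn (fun x => G (u x)) Ω := hGc.comp cu hI
  have cG' : ContinuousOn (fun x => G' (u x)) Ω := hG'.comp cu hI
  have cP : ContinuousOn (gradient u) Ω := hu.continuousOn_gradient hΩ (by norm_num)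
  have cQ : ContinuousOn (gradient η) Ω := hη.contDiffOn.continuousOn_gradient hΩ le_rfl
  have cη : ContinuousOn η Ω := hη.continuous.continuousOn
  have int1 : Integrable (fun x => G' (u x) * ‖gradient u x‖ ^ 2 * η x ^ 2 +
      2 * G (u x) * η x * inner ℝ (gradient u x) (gradient η x)) := by
    refine integrable_of_continuousOn_of_eq_zero hc hs ?_ fun x hx => ?_
    · exact ((cG'.mul (cP.norm.pow 2)).mul (cη.pow 2)).add
        (((continuousOn_const.mul cG).mul cη).mul (cP.inner cQ))
    · simp [image_eq_zero_of_notMem_tsupport hx]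
  have int2 : Integrable (fun x => f (u x) * G (u x) * η x ^ 2) := by
    refine integrable_of_continuousOn_of_eq_zero hc hs ((cf.mul cG).mul (cη.pow 2)) fun x hx => ?_
    simp [image_eq_zero_of_notMem_tsupport hx]
  refine ⟨int1.sub int2, ?_⟩
  rw [integral_sub int1 int2, sub_eq_zero]
  have hη2 : ContDiff ℝ 1 fun x => η x ^ 2 := hη.pow 2
  have hs2 : tsupport (fun x => η x ^ 2) ⊆ tsupport η :=
    closure_mono fun x hx h => hx (by simp [h])
  have hGu : ContDiffOn ℝ 1 (fun x => G (u x)) Ω :=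
    (contDiffOn_one_of_hasDerivWithinAt (uniqueDiffOn_Ico 0 1) hG hG').comp
      (hu.of_le (by norm_num)) hI
  have hφ := hGu.mul_of_tsupport_subset hΩ hη2 (hs2.trans hs)
  have hφs : tsupport (fun x => G (u x) * η x ^ 2) ⊆ tsupport η :=
    closure_mono fun x hx h => hx (by simp [h])
  have hφc : HasCompactSupport fun x => G (u x) * η x ^ 2 :=
    hc.mono' ((subset_tsupport _).trans hφs)
  have key := integral_inner_gradient_eq hΩ hu hφ hφc (hφs.trans hs)
  calc _ = ∫ x, inner ℝ (gradient u x) (gradient (fun y => G (u y) * η y ^ 2) x) := by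
        refine integral_congr_ae (Eventually.of_forall fun x => ?_)
        by_cases hx : x ∈ tsupport η
        · have h1 := HasDerivWithinAt.comp_hasGradientAt hG hΩ hI (hs hx)
            ((hu.contDiffAt (hΩ.mem_nhds (hs hx))).differentiableAt two_ne_zero)
          have h2 := (hη.differentiable one_ne_zero x).hasGradientAt
          have h3 := h1.mul' (h2.mul' h2)
          have h4 : (fun y => G (u y) * η y ^ 2) = fun y => G (u y) * (η y * η y) := by
            ext y; ring
          simp only [h4, h3.gradient, inner_add_right, real_inner_smul_right,
            real_inner_self_eq_norm_sq]
          ring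
        · beta_reduce
          rw [gradient_eq_zero_of_notMem_tsupport fun h => hx (hφs h), inner_zero_right]
          simp [image_eq_zero_of_notMem_tsupport hx]
    _ = ∫ x, -lap u x * (G (u x) * η x ^ 2) := key
    _ = _ := by
        refine integral_congr_ae (Eventually.of_forall fun x => ?_)
        by_cases hx : x ∈ tsupport η
        · simp only [heq x (hs hx)]
          ring
        · simp [image_eq_zero_of_notMem_tsupport hx]

theorem StableSol.integral_test_function_nonneg {f' G G' : ℝ → ℝ} {u η : E → ℝ}
    (hf' : ContinuousOn f' (Ico 0 1))
    (hu : ContDiffOn ℝ 2 u (ball 0 1)) (hI : MapsTo u (ball 0 1) (Ico 0 1))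
    (hst : StableSol f' u (ball 0 1))
    (hG : ∀ t ∈ Ico (0 : ℝ) 1, HasDerivWithinAt G (G' t) (Ico 0 1) t)
    (hG' : ContinuousOn G' (Ico 0 1)) (hη : ContDiff ℝ 1 η) {r : ℝ} (hr : r < 1)
    (hs : tsupport η ⊆ closedBall 0 r) :
    Integrable (fun x => (G' (u x) * η x) ^ 2 * ‖gradient u x‖ ^ 2 +
      2 * (G' (u x) * η x * G (u x) * inner ℝ (gradient u x) (gradient η x)) +
        G (u x) ^ 2 * ‖gradient η x‖ ^ 2 - f' (u x) * (G (u x) * η x) ^ 2) ∧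
    0 ≤ ∫ x, ((G' (u x) * η x) ^ 2 * ‖gradient u x‖ ^ 2 +
      2 * (G' (u x) * η x * G (u x) * inner ℝ (gradient u x) (gradient η x)) +
        G (u x) ^ 2 * ‖gradient η x‖ ^ 2 - f' (u x) * (G (u x) * η x) ^ 2) ∧
    ContDiff ℝ 1 (fun x => G (u x) * η x) ∧
    ∀ x, ‖gradient (fun y => G (u y) * η y) x‖ ^ 2 =
      (G' (u x) * η x) ^ 2 * ‖gradient u x‖ ^ 2 +
      2 * (G' (u x) * η x * G (u x) * inner ℝ (gradient u x) (gradient η x)) +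
        G (u x) ^ 2 * ‖gradient η x‖ ^ 2 := by
  have hΩ : IsOpen (ball (0 : E) 1) := isOpen_ball
  have hc : HasCompactSupport η := HasCompactSupport.of_support_subset_isCompact
    (isCompact_closedBall 0 r) ((subset_tsupport _).trans hs)
  have hsΩ := hs.trans (closedBall_subset_ball hr)
  have hGc : ContinuousOn G (Ico 0 1) := fun t ht => (hG t ht).continuousWithinAt
  have cu := hu.continuousOn
  have cf : ContinuousOn (fun x => f' (u x)) (ball 0 1) := hf'.comp cu hI
  have cG : ContinuousOn (fun x => G (u x)) (ball 0 1) := hGc.comp cu hI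
  have cG' : ContinuousOn (fun x => G' (u x)) (ball 0 1) := hG'.comp cu hI
  have cP : ContinuousOn (gradient u) (ball 0 1) := hu.continuousOn_gradient hΩ (by norm_num)
  have cQ : ContinuousOn (gradient η) (ball 0 1) := hη.contDiffOn.continuousOn_gradient hΩ le_rfl
  have cη : ContinuousOn η (ball 0 1) := hη.continuous.continuousOn
  have hGu : ContDiffOn ℝ 1 (fun x => G (u x)) (ball 0 1) :=
    (contDiffOn_one_of_hasDerivWithinAt (uniqueDiffOn_Ico 0 1) hG hG').comp
      (hu.of_le (by norm_num)) hI
  have hφ := hGu.mul_of_tsupport_subset hΩ hη hsΩ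
  have hφs : tsupport (fun x => G (u x) * η x) ⊆ tsupport η :=
    closure_mono fun x hx h => hx (by simp [h])
  have hgrad : ∀ x, ‖gradient (fun y => G (u y) * η y) x‖ ^ 2 =
      (G' (u x) * η x) ^ 2 * ‖gradient u x‖ ^ 2 +
      2 * (G' (u x) * η x * G (u x) * inner ℝ (gradient u x) (gradient η x)) +
        G (u x) ^ 2 * ‖gradient η x‖ ^ 2 := by
    intro x
    by_cases hx : x ∈ tsupport η
    · have h1 := HasDerivWithinAt.comp_hasGradientAt hG hΩ hI (hsΩ hx)
        ((hu.contDiffAt (hΩ.mem_nhds (hsΩ hx))).differentiableAt two_ne_zero)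
      have h3 := h1.mul' (hη.differentiable one_ne_zero x).hasGradientAt
      rw [h3.gradient, norm_add_sq_real, smul_smul, norm_smul, norm_smul, real_inner_smul_left,
        real_inner_smul_right, mul_pow, mul_pow, Real.norm_eq_abs, Real.norm_eq_abs, sq_abs, sq_abs]
      ring
    · rw [gradient_eq_zero_of_notMem_tsupport fun h => hx (hφs h),
        gradient_eq_zero_of_notMem_tsupport hx]
      simp [image_eq_zero_of_notMem_tsupport hx]
  refine ⟨?_, ?_, hφ, hgrad⟩
  · refine integrable_of_continuousOn_of_eq_zero hc hsΩ ?_ fun x hx => ?_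
    · exact (((((cG'.mul cη).pow 2).mul (cP.norm.pow 2)).add
        (continuousOn_const.mul (((cG'.mul cη).mul cG).mul (cP.inner cQ)))).add
        ((cG.pow 2).mul (cQ.norm.pow 2))).sub (cf.mul ((cG.mul cη).pow 2))
    · simp [image_eq_zero_of_notMem_tsupport hx, gradient_eq_zero_of_notMem_tsupport hx]
  · have := hst.of_contDiff_one cf hφ hr (hφs.trans hs)
    simpa only [hgrad] using this

theorem HasDerivWithinAt.rpow_mul_pow_succ {g : ℝ → ℝ} {D γ t : ℝ} {I : Set ℝ} (hγ : 0 < γ)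
    (hg0 : ∀ t ∈ I, 0 ≤ g t) (ht : t ∈ I) (hg : HasDerivWithinAt g D I t) (k : ℕ) :
    HasDerivWithinAt (fun t => g t ^ γ * g t ^ (k + 1))
      ((γ + (k + 1)) * D * (g t ^ γ * g t ^ k)) I t := by
  have key : ∀ (j : ℕ), ∀ s ∈ I, g s ^ γ * g s ^ j = g s ^ (γ + j) := fun j s hs =>
    (Real.rpow_add_natCast' (hg0 s hs) (by positivity)).symm
  have h1 := hg.rpow_const (p := γ + (k + 1 : ℕ))
    (Or.inr (by push_cast; linarith [Nat.cast_nonneg (α := ℝ) k]))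
  have h2 := h1.congr (fun s hs => key (k + 1) s hs) (key (k + 1) t ht)
  refine h2.congr_deriv ?_
  rw [key k t ht]
  push_cast
  rw [show γ + ((k : ℝ) + 1) - 1 = γ + k by ring]
  ring

theorem two_mul_inner_le (P Q : E) {δ : ℝ} (hδ : 0 < δ) (x y : ℝ) :
    2 * (x * y * inner ℝ P Q) ≤ δ * x ^ 2 * ‖P‖ ^ 2 + δ⁻¹ * y ^ 2 * ‖Q‖ ^ 2 := by
  have h1 : 0 ≤ ‖(δ * x) • P - y • Q‖ ^ 2 := sq_nonneg _
  rw [norm_sub_sq_real, norm_smul, norm_smul, real_inner_smul_left, real_inner_smul_right, mul_pow,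
    mul_pow, Real.norm_eq_abs, Real.norm_eq_abs, sq_abs, sq_abs] at h1
  refine le_of_mul_le_mul_left ?_ hδ
  have h2 : δ * δ⁻¹ = 1 := mul_inv_cancel₀ hδ.ne'
  linear_combination h1 - y ^ 2 * ‖Q‖ ^ 2 * h2

end Energy

section EnergyBound

variable {n : ℕ}

local notation "E" => EuclideanSpace ℝ (Fin n)

theorem HasDerivWithinAt.sq_rpow_mul_pow_succ {g : ℝ → ℝ} {D β t : ℝ} {I : Set ℝ} (hβ : 0 < β)
    (hg0 : ∀ t ∈ I, 0 ≤ g t) (ht : t ∈ I) (hg : HasDerivWithinAt g D I t) (k : ℕ) :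
    HasDerivWithinAt (fun t => (g t ^ β) ^ 2 * g t ^ (k + 1))
      ((2 * β + (k + 1)) * D * ((g t ^ β) ^ 2 * g t ^ k)) I t := by
  have key : ∀ s ∈ I, (g s ^ β) ^ 2 = g s ^ (2 * β) := fun s hs => by
    rw [← Real.rpow_mul_natCast (hg0 s hs)]
    congr 1
    push_cast
    ring
  rw [key t ht]
  exact (HasDerivWithinAt.rpow_mul_pow_succ (by positivity) hg0 ht hg k).congr
    (fun s hs => by simp only [key s hs]) (by simp only [key t ht])

theorem exists_energy_bound {θ K β : ℝ} (hθ : 0 < θ) (hK : 0 ≤ K) (hβ : 0 < β)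
    (hβ' : β < Real.sqrt (1 + θ) - 1) :
    ∃ C : ℝ, 0 ≤ C ∧ ∀ (f f' f'' : ℝ → ℝ) (u η : E → ℝ) (r : ℝ), C2On01 f f' f'' →
      (∀ t ∈ Ico (0 : ℝ) 1, 0 ≤ f t) →
      (∀ t ∈ Ico (0 : ℝ) 1, (1 + θ) * f' t ^ 2 - K ≤ f'' t * f t) →
      ContDiffOn ℝ 2 u (ball 0 1) → MapsTo u (ball 0 1) (Ico 0 1) →
      (∀ x ∈ ball (0 : E) 1, -lap u x = f (u x)) → StableSol f' u (ball 0 1) →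
      ContDiff ℝ 1 η → r < 1 → tsupport η ⊆ closedBall 0 r →
      ContDiff ℝ 1 (fun x => f (u x) ^ β * f (u x) ^ 2 * η x) ∧
      ContDiff ℝ 1 (fun x => u x ^ β * u x ^ 2 * η x) ∧
      (∫ x, ‖gradient (fun x => f (u x) ^ β * f (u x) ^ 2 * η x) x‖ ^ 2) +
        (∫ x, ‖gradient (fun x => u x ^ β * u x ^ 2 * η x) x‖ ^ 2) ≤
      C * ∫ x, ((f (u x) ^ β * f (u x) ^ 2) ^ 2 + (u x ^ β * u x ^ 2) ^ 2) *
        (η x ^ 2 + ‖gradient η x‖ ^ 2) := by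
  obtain ⟨a, b, c, C, hc, hC, hpt⟩ := exists_pointwise_energy_bound hθ hK hβ hβ'
  refine ⟨2 * (2 + β) ^ 2 * (C / c) + 2, by positivity, ?_⟩
  intro f f' f'' u η r ⟨hf, hf', hf''⟩ hf0 hff hu hI heq hst hη hr hs
  have hΩ : IsOpen (ball (0 : E) 1) := isOpen_ball
  have hcs : HasCompactSupport η := HasCompactSupport.of_support_subset_isCompact
    (isCompact_closedBall 0 r) ((subset_tsupport _).trans hs)
  have hsΩ := hs.trans (closedBall_subset_ball hr)
  have cf : ContinuousOn f (Ico 0 1) := fun t ht => (hf t ht).continuousWithinAt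
  have cf' : ContinuousOn f' (Ico 0 1) := fun t ht => (hf' t ht).continuousWithinAt
  have ct : ContinuousOn (fun t : ℝ => t) (Ico 0 1) := continuousOn_id
  have cX : ContinuousOn (fun t => f t ^ β) (Ico 0 1) := cf.rpow_const fun _ _ => Or.inr hβ.le
  have cY : ContinuousOn (fun t : ℝ => t ^ β) (Ico 0 1) := ct.rpow_const fun _ _ => Or.inr hβ.le
  have hid : ∀ t ∈ Ico (0 : ℝ) 1, HasDerivWithinAt (fun t : ℝ => t) 1 (Ico 0 1) t :=
    fun t _ => hasDerivWithinAt_id t _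
  have hid0 : ∀ t ∈ Ico (0 : ℝ) 1, 0 ≤ t := fun t ht => ht.1
  obtain ⟨i2, p2, dX, gX⟩ := StableSol.integral_test_function_nonneg cf' hu hI hst
    (G := fun t => f t ^ β * f t ^ 2) (G' := fun t => (2 + β) * (f' t * (f t ^ β * f t)))
    (fun t ht => ((hf t ht).rpow_mul_pow_succ hβ hf0 ht 1).congr_deriv (by push_cast; ring))
    (continuousOn_const.mul (cf'.mul (cX.mul cf))) hη hr hs
  obtain ⟨-, -, dY, gY⟩ := StableSol.integral_test_function_nonneg cf' hu hI hst
    (G := fun t => t ^ β * t ^ 2) (G' := fun t => (2 + β) * (t ^ β * t))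
    (fun t ht => ((hid t ht).rpow_mul_pow_succ hβ hid0 ht 1).congr_deriv (by push_cast; ring))
    (continuousOn_const.mul (cY.mul ct)) hη hr hs
  obtain ⟨i1, e1⟩ := integral_test_function_eq hΩ cf hu hI heq
    (G := fun t => f' t * ((f t ^ β) ^ 2 * f t ^ 3))
    (G' := fun t => f'' t * ((f t ^ β) ^ 2 * f t ^ 3) +
      f' t * ((3 + 2 * β) * f' t * ((f t ^ β) ^ 2 * f t ^ 2)))
    (fun t ht => ((hf' t ht).mul ((hf t ht).sq_rpow_mul_pow_succ hβ hf0 ht 2)).congr_deriv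
      (by push_cast; ring))
    ((hf''.mul ((cX.pow 2).mul (cf.pow 3))).add
      (cf'.mul ((continuousOn_const.mul cf').mul ((cX.pow 2).mul (cf.pow 2))))) hη hcs hsΩ
  obtain ⟨i3, e3⟩ := integral_test_function_eq hΩ cf hu hI heq
    (G := fun t => t * ((f t ^ β) ^ 2 * f t ^ 2))
    (G' := fun t => (f t ^ β) ^ 2 * f t ^ 2 +
      t * ((2 + 2 * β) * f' t * ((f t ^ β) ^ 2 * f t)))
    (fun t ht => ((hid t ht).mul ((hf t ht).sq_rpow_mul_pow_succ hβ hf0 ht 1)).congr_deriv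
      (by push_cast; ring))
    (((cX.pow 2).mul (cf.pow 2)).add
      (ct.mul ((continuousOn_const.mul cf').mul ((cX.pow 2).mul cf)))) hη hcs hsΩ
  obtain ⟨i4, e4⟩ := integral_test_function_eq hΩ cf hu hI heq
    (G := fun t => (t ^ β) ^ 2 * t ^ 3) (G' := fun t => (3 + 2 * β) * ((t ^ β) ^ 2 * t ^ 2))
    (fun t ht => ((hid t ht).sq_rpow_mul_pow_succ hβ hid0 ht 2).congr_deriv (by push_cast; ring))
    (continuousOn_const.mul ((cY.pow 2).mul (ct.pow 2))) hη hcs hsΩ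
  have cP : ContinuousOn (gradient u) (ball 0 1) := hu.continuousOn_gradient hΩ (by norm_num)
  have cQ : ContinuousOn (gradient η) (ball 0 1) := hη.contDiffOn.continuousOn_gradient hΩ le_rfl
  have cη : ContinuousOn η (ball 0 1) := hη.continuous.continuousOn
  have cu := hu.continuousOn
  set A : E → ℝ := fun x => ((f' (u x) * (f (u x) ^ β * f (u x))) ^ 2 + (u x ^ β * u x) ^ 2) *
    ‖gradient u x‖ ^ 2 * η x ^ 2 with hA
  set B : E → ℝ := fun x => ((f (u x) ^ β * f (u x) ^ 2) ^ 2 + (u x ^ β * u x ^ 2) ^ 2) *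
    (η x ^ 2 + ‖gradient η x‖ ^ 2) with hB
  have iA : Integrable A := by
    refine integrable_of_continuousOn_of_eq_zero hcs hsΩ ?_ fun x hx => ?_
    · have h : ContinuousOn (fun t => (f' t * (f t ^ β * f t)) ^ 2 + (t ^ β * t) ^ 2) (Ico 0 1) :=
        ((cf'.mul (cX.mul cf)).pow 2).add ((cY.mul ct).pow 2)
      exact ((h.comp cu hI).mul (cP.norm.pow 2)).mul (cη.pow 2)
    · simp [hA, image_eq_zero_of_notMem_tsupport hx]
  have iB : Integrable B := by
    refine integrable_of_continuousOn_of_eq_zero hcs hsΩ ?_ fun x hx => ?_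
    · have h : ContinuousOn (fun t => (f t ^ β * f t ^ 2) ^ 2 + (t ^ β * t ^ 2) ^ 2) (Ico 0 1) :=
        ((cX.mul (cf.pow 2)).pow 2).add ((cY.mul (ct.pow 2)).pow 2)
      exact (h.comp cu hI).mul ((cη.pow 2).add (cQ.norm.pow 2))
    · simp only [hB, image_eq_zero_of_notMem_tsupport hx, gradient_eq_zero_of_notMem_tsupport hx,
        norm_zero]
      ring
  have hle : c * ∫ x, A x ≤ C * ∫ x, B x := by
    have h1 := integral_mono (((i2.sub i1).sub (i3.const_mul a)).sub (i4.const_mul b))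
      ((iB.const_mul C).sub (iA.const_mul c)) ?_
    · rw [integral_sub' ((i2.sub i1).sub (i3.const_mul a)) (i4.const_mul b),
        integral_sub' (i2.sub i1) (i3.const_mul a), integral_sub' i2 i1,
        integral_sub' (iB.const_mul C) (iA.const_mul c), integral_const_mul, integral_const_mul,
        integral_const_mul, integral_const_mul, e1, e3, e4] at h1
      linarith
    · intro x
      by_cases hx : x ∈ tsupport η
      · have hux := hI (hsΩ hx)
        have := hpt (f (u x)) (f' (u x)) (f'' (u x)) (u x) (η x) (‖gradient u x‖ ^ 2)
          (‖gradient η x‖ ^ 2) (inner ℝ (gradient u x) (gradient η x)) _ _ (hf0 _ hux) hux.1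
          (sq_nonneg _) (sq_nonneg _) rfl rfl (fun δ hδ x y => two_mul_inner_le _ _ hδ x y)
          (hff _ hux)
        simp only [Pi.sub_apply, hA, hB]
        linarith
      · simp only [Pi.sub_apply, hA, hB, image_eq_zero_of_notMem_tsupport hx,
          gradient_eq_zero_of_notMem_tsupport hx, norm_zero, inner_zero_right]
        apply le_of_eq
        ring
  refine ⟨dX, dY, ?_⟩
  have iX : Integrable fun x => ‖gradient (fun x => f (u x) ^ β * f (u x) ^ 2 * η x) x‖ ^ 2 := by
    refine integrable_of_continuousOn_of_eq_zero hcs hsΩ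
      ((dX.contDiffOn.continuousOn_gradient hΩ le_rfl).norm.pow 2) fun x hx => ?_
    rw [gX, gradient_eq_zero_of_notMem_tsupport hx, image_eq_zero_of_notMem_tsupport hx, norm_zero]
    ring
  have iY : Integrable fun x => ‖gradient (fun x => u x ^ β * u x ^ 2 * η x) x‖ ^ 2 := by
    refine integrable_of_continuousOn_of_eq_zero hcs hsΩ
      ((dY.contDiffOn.continuousOn_gradient hΩ le_rfl).norm.pow 2) fun x hx => ?_
    rw [gY, gradient_eq_zero_of_notMem_tsupport hx, image_eq_zero_of_notMem_tsupport hx, norm_zero]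
    ring
  have hsum : (∫ x, ‖gradient (fun x => f (u x) ^ β * f (u x) ^ 2 * η x) x‖ ^ 2) +
        (∫ x, ‖gradient (fun x => u x ^ β * u x ^ 2 * η x) x‖ ^ 2) ≤
      2 * (2 + β) ^ 2 * (∫ x, A x) + 2 * ∫ x, B x := by
    rw [← integral_add iX iY, ← integral_const_mul, ← integral_const_mul,
      ← integral_add (iA.const_mul _) (iB.const_mul _)]
    refine integral_mono (iX.add iY) ((iA.const_mul _).add (iB.const_mul _)) fun x => ?_
    have h1 := two_mul_inner_le (gradient u x) (gradient η x) one_pos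
      ((2 + β) * (f' (u x) * (f (u x) ^ β * f (u x))) * η x) (f (u x) ^ β * f (u x) ^ 2)
    have h2 := two_mul_inner_le (gradient u x) (gradient η x) one_pos
      ((2 + β) * (u x ^ β * u x) * η x) (u x ^ β * u x ^ 2)
    have h3 : 0 ≤ ((f (u x) ^ β * f (u x) ^ 2) ^ 2 + (u x ^ β * u x ^ 2) ^ 2) * η x ^ 2 := by
      positivity
    simp only [gX, gY, hA, hB]
    rw [inv_one] at h1 h2
    linarith
  have h4 : ∫ x, A x ≤ C / c * ∫ x, B x := by
    rw [div_mul_eq_mul_div, le_div_iff₀ hc]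
    linarith
  have h5 : 2 * (2 + β) ^ 2 * (∫ x, A x) ≤ 2 * (2 + β) ^ 2 * (C / c * ∫ x, B x) := by gcongr
  linarith

end EnergyBound

section Sobolev

variable {n : ℕ}

local notation "E" => EuclideanSpace ℝ (Fin n)

open scoped NNReal ENNReal

theorem eLpNorm_le_eLpNorm_mul_of_tsupport_subset {F : Type*} [NormedAddCommGroup F] {g : E → F}
    (hg : Continuous g) (hs : tsupport g ⊆ closedBall 0 1) {p q : ℝ≥0∞} (hpq : p ≤ q) :
    eLpNorm g p volume ≤
      eLpNorm g q volume * volume (closedBall (0 : E) 1) ^ (1 / p.toReal - 1 / q.toReal) := by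
  have h0 := (subset_tsupport g).trans hs
  have hc : HasCompactSupport g :=
    HasCompactSupport.of_support_subset_isCompact (isCompact_closedBall 0 1) h0
  have h := eLpNorm_le_eLpNorm_mul_rpow_measure_univ
    (μ := volume.restrict (closedBall (0 : E) 1)) (f := g) hpq
    (hg.memLp_of_hasCompactSupport (p := 1) hc).1.restrict
  rwa [eLpNorm_restrict_eq_of_support_subset h0, eLpNorm_restrict_eq_of_support_subset h0,
    Measure.restrict_apply_univ] at h

theorem enorm_le_eLpNorm_fderiv_of_dim_one {w : EuclideanSpace ℝ (Fin 1) → ℝ}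
    (hw : ContDiff ℝ 1 w) (hc : HasCompactSupport w) (x : EuclideanSpace ℝ (Fin 1)) :
    ‖w x‖ₑ ≤ eLpNorm (fderiv ℝ w) 1 volume := by
  let L : ℝ ≃ₗᵢ[ℝ] EuclideanSpace ℝ (Fin 1) := (OrthonormalBasis.singleton (Fin 1) ℝ).repr
  have hv : ContDiff ℝ 1 (w ∘ L) := hw.comp L.toContinuousLinearEquiv.contDiff
  have hvc : HasCompactSupport (w ∘ L) := hc.comp_homeomorph L.toHomeomorph
  have h1 := hvc.enorm_le_lintegral_Ici_deriv hv (L.symm x)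
  simp only [Function.comp_apply, LinearIsometryEquiv.apply_symm_apply] at h1
  rw [eLpNorm_one_eq_lintegral_enorm]
  refine h1.trans ((setLIntegral_le_lintegral _ _).trans ?_)
  rw [← L.measurePreserving.lintegral_comp_emb L.toHomeomorph.measurableEmbedding]
  refine lintegral_mono fun y => ?_
  have h2 : deriv (w ∘ L) y = fderiv ℝ w (L y) (L 1) := by
    have hL : HasFDerivAt (⇑L) (L.toContinuousLinearEquiv : ℝ →L[ℝ] _) y :=
      L.toContinuousLinearEquiv.hasFDerivAt
    exact ((hw.differentiable one_ne_zero (L y)).hasFDerivAt.comp y hL).hasDerivAt.deriv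
  rw [h2]
  have h3 := (fderiv ℝ w (L y)).le_opNorm (L 1)
  rw [LinearIsometryEquiv.norm_map, norm_one, mul_one] at h3
  exact enorm_le_iff_norm_le.2 h3

theorem exists_eLpNorm_le_eLpNorm_fderiv_two (hn : 1 ≤ n) {q : ℝ} (hq : 2 < q)
    (hnq : n ≤ 2 ∨ (2 : ℝ)⁻¹ - (n : ℝ)⁻¹ ≤ q⁻¹) :
    ∃ C : ℝ≥0, ∀ w : E → ℝ, ContDiff ℝ 1 w → tsupport w ⊆ closedBall 0 1 →
      eLpNorm w (ENNReal.ofReal q) volume ≤ C * eLpNorm (fderiv ℝ w) 2 volume := by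
  suffices h : ∃ p : ℝ≥0∞, 1 ≤ p ∧ p ≤ 2 ∧ ∃ C : ℝ≥0, ∀ w : E → ℝ, ContDiff ℝ 1 w →
      tsupport w ⊆ closedBall 0 1 →
      eLpNorm w (ENNReal.ofReal q) volume ≤ C * eLpNorm (fderiv ℝ w) p volume by
    obtain ⟨p, hp1, hp2, C, hC⟩ := h
    have hV : volume (closedBall (0 : E) 1) ^ (1 / p.toReal - 1 / (2 : ℝ≥0∞).toReal) ≠ ∞ := by
      refine ENNReal.rpow_ne_top_of_nonneg ?_ (isCompact_closedBall _ _).measure_lt_top.ne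
      rw [sub_nonneg]
      have h1 : p.toReal ≤ (2 : ℝ≥0∞).toReal := ENNReal.toReal_mono (by simp) hp2
      have h0 : 0 < p.toReal :=
        ENNReal.toReal_pos (zero_lt_one.trans_le hp1).ne' (hp2.trans_lt (by simp)).ne
      gcongr
    refine ⟨C * (volume (closedBall (0 : E) 1) ^
      (1 / p.toReal - 1 / (2 : ℝ≥0∞).toReal)).toNNReal, fun w hw hs => ?_⟩
    refine (hC w hw hs).trans ?_
    rw [ENNReal.coe_mul, ENNReal.coe_toNNReal hV, mul_assoc, mul_comm (_ ^ _)]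
    gcongr
    exact eLpNorm_le_eLpNorm_mul_of_tsupport_subset (hw.continuous_fderiv one_ne_zero)
      ((tsupport_fderiv_subset ℝ).trans hs) hp2
  have hq0 : (0 : ℝ) < q := by linarith
  rcases hn.eq_or_lt with rfl | hn1
  · refine ⟨1, le_rfl, by norm_num,
      (volume (closedBall (0 : EuclideanSpace ℝ (Fin 1)) 1) ^ q⁻¹).toNNReal, fun w hw hs => ?_⟩
    have h0 := (subset_tsupport w).trans hs
    have hc : HasCompactSupport w :=
      HasCompactSupport.of_support_subset_isCompact (isCompact_closedBall 0 1) h0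
    rw [← eLpNorm_restrict_eq_of_support_subset h0, ENNReal.coe_toNNReal
      (ENNReal.rpow_ne_top_of_nonneg (by positivity) (isCompact_closedBall _ _).measure_lt_top.ne),
      mul_comm]
    refine (eLpNorm_le_of_ae_enorm_bound
      (ae_of_all _ (enorm_le_eLpNorm_fderiv_of_dim_one hw hc))).trans ?_
    rw [Measure.restrict_apply_univ, ENNReal.toReal_ofReal hq0.le, smul_eq_mul]
  · have key : ∀ p : ℝ, 1 ≤ p → p ≤ 2 → p < n → p⁻¹ - (n : ℝ)⁻¹ ≤ q⁻¹ →
        ∃ p : ℝ≥0∞, 1 ≤ p ∧ p ≤ 2 ∧ ∃ C : ℝ≥0, ∀ w : E → ℝ, ContDiff ℝ 1 w →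
        tsupport w ⊆ closedBall 0 1 →
        eLpNorm w (ENNReal.ofReal q) volume ≤ C * eLpNorm (fderiv ℝ w) p volume := by
      intro p hp1 hp2 hpn hpq
      lift p to ℝ≥0 using zero_le_one.trans hp1
      refine ⟨p, by exact_mod_cast hp1, by exact_mod_cast hp2,
        eLpNormLESNormFDerivOfLeConst ℝ volume (closedBall (0 : E) 1) p q.toNNReal,
        fun w hw hs => ?_⟩
      refine eLpNorm_le_eLpNorm_fderiv_of_le volume hw ((subset_tsupport w).trans hs)
        (by exact_mod_cast hp1) ?_ ?_ isBounded_closedBall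
      · rw [finrank_euclideanSpace_fin]
        exact_mod_cast hpn
      · rw [finrank_euclideanSpace_fin, Real.coe_toNNReal _ hq0.le, NNReal.coe_inv]
        exact hpq
    rcases (Nat.succ_le_of_lt hn1).eq_or_lt with h2 | h2
    · subst h2
      refine key (2 * q / (q + 2)) ?_ ?_ ?_ ?_
      · rw [le_div_iff₀ (by positivity)]
        linarith
      · rw [div_le_iff₀ (by positivity)]
        linarith
      · push_cast
        rw [div_lt_iff₀ (by positivity)]
        linarith
      · apply le_of_eq
        push_cast
        field_simp
        ring
    · exact key 2 (by norm_num) le_rfl (by exact_mod_cast h2) (hnq.resolve_left (by omega))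

theorem exists_sobolev_inequality (hn : 1 ≤ n) {q : ℝ} (hq : 2 < q)
    (hnq : n ≤ 2 ∨ (2 : ℝ)⁻¹ - (n : ℝ)⁻¹ ≤ q⁻¹) :
    ∃ C : ℝ, 0 ≤ C ∧ ∀ w : E → ℝ, ContDiff ℝ 1 w → tsupport w ⊆ closedBall 0 1 →
      (∫ x, |w x| ^ q) ^ (2 / q) ≤ C * ∫ x, ‖gradient w x‖ ^ 2 := by
  obtain ⟨C, hC⟩ := exists_eLpNorm_le_eLpNorm_fderiv_two hn hq hnq
  refine ⟨C ^ 2, by positivity, fun w hw hs => ?_⟩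
  have hq0 : (0 : ℝ) < q := by linarith
  have hc : HasCompactSupport w := HasCompactSupport.of_support_subset_isCompact
    (isCompact_closedBall 0 1) ((subset_tsupport w).trans hs)
  have h := hC w hw hs
  rw [MemLp.eLpNorm_eq_integral_rpow_norm (by simpa using hq0) ENNReal.ofReal_ne_top
      (hw.continuous.memLp_of_hasCompactSupport hc),
    MemLp.eLpNorm_eq_integral_rpow_norm two_ne_zero ENNReal.ofNat_ne_top
      ((hw.continuous_fderiv one_ne_zero).memLp_of_hasCompactSupport (hc.fderiv ℝ)),
    ENNReal.toReal_ofReal hq0.le, ENNReal.toReal_ofNat, ← ENNReal.ofReal_coe_nnreal,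
    ← ENNReal.ofReal_mul (by positivity), ENNReal.ofReal_le_ofReal_iff (by positivity)] at h
  have hA : 0 ≤ ∫ x, |w x| ^ q := by positivity
  have hB : 0 ≤ ∫ x, ‖gradient w x‖ ^ 2 := by positivity
  have h2 : ((∫ x, ‖fderiv ℝ w x‖ ^ (2 : ℝ)) ^ (2 : ℝ)⁻¹) ^ 2 = ∫ x, ‖gradient w x‖ ^ 2 := by
    simp_rw [norm_gradient_eq_norm_fderiv, Real.rpow_two] at hB ⊢
    rw [← Real.rpow_mul_natCast hB]
    norm_num
  have h3 : ((∫ x, ‖w x‖ ^ q) ^ q⁻¹) ^ 2 = (∫ x, |w x| ^ q) ^ (2 / q) := by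
    simp_rw [Real.norm_eq_abs]
    rw [← Real.rpow_mul_natCast hA]
    congr 1
    push_cast
    ring
  rw [← h2, ← h3, ← mul_pow]
  gcongr

end Sobolev

section Interpolation

theorem integral_rpow_mul_rpow_le {α : Type*} [MeasurableSpace α] {μ : Measure α} {a b : α → ℝ}
    (ha : ∀ x, 0 ≤ a x) (hb : ∀ x, 0 ≤ b x) (ia : Integrable a μ) (ib : Integrable b μ) {t : ℝ}
    (h0 : 0 < t) (h1 : t < 1) :
    Integrable (fun x => a x ^ t * b x ^ (1 - t)) μ ∧
      ∫ x, a x ^ t * b x ^ (1 - t) ∂μ ≤ (∫ x, a x ∂μ) ^ t * (∫ x, b x ∂μ) ^ (1 - t) := by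
  have h1' : 0 < 1 - t := by linarith
  have hm : AEStronglyMeasurable (fun x => a x ^ t * b x ^ (1 - t)) μ :=
    ((ia.aemeasurable.pow_const t).mul (ib.aemeasurable.pow_const _)).aestronglyMeasurable
  have h0' : ∀ x, 0 ≤ a x ^ t * b x ^ (1 - t) := fun x =>
    mul_nonneg (Real.rpow_nonneg (ha x) _) (Real.rpow_nonneg (hb x) _)
  refine ⟨((ia.const_mul t).add (ib.const_mul (1 - t))).mono' hm (Eventually.of_forall fun x => ?_),
    ?_⟩
  · rw [Real.norm_of_nonneg (h0' x)]
    exact Real.geom_mean_le_arith_mean2_weighted h0.le h1'.le (ha x) (hb x) (by ring)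
  · have hla := ia.lintegral_lt_top
    have hlb := ib.lintegral_lt_top
    rw [integral_eq_lintegral_of_nonneg_ae (Eventually.of_forall h0') hm,
      integral_eq_lintegral_of_nonneg_ae (Eventually.of_forall ha) ia.1,
      integral_eq_lintegral_of_nonneg_ae (Eventually.of_forall hb) ib.1, ENNReal.toReal_rpow,
      ENNReal.toReal_rpow, ← ENNReal.toReal_mul]
    refine ENNReal.toReal_mono (ENNReal.mul_ne_top (ENNReal.rpow_ne_top_of_nonneg h0.le hla.ne)
      (ENNReal.rpow_ne_top_of_nonneg h1'.le hlb.ne)) ?_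
    refine le_trans (le_of_eq (lintegral_congr fun x => ?_)) (ENNReal.lintegral_mul_norm_pow_le
      ia.aemeasurable.ennreal_ofReal ib.aemeasurable.ennreal_ofReal h0.le h1'.le (by ring))
    rw [ENNReal.ofReal_mul (Real.rpow_nonneg (ha x) _),
      ENNReal.ofReal_rpow_of_nonneg (ha x) h0.le, ENNReal.ofReal_rpow_of_nonneg (hb x) h1'.le]

theorem le_rpow_mul_of_le_mul_rpow_mul_rpow {C S T t : ℝ} (hC : 0 ≤ C) (hS : 0 ≤ S) (hT : 0 ≤ T)
    (ht : t < 1) (h : S ≤ C * (S ^ t * T ^ (1 - t))) : S ≤ C ^ (1 - t)⁻¹ * T := by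
  have ht' : 0 < 1 - t := by linarith
  rcases hS.eq_or_lt with rfl | hS'
  · positivity
  have h1 : S ^ (1 - t) ≤ C * T ^ (1 - t) := by
    rw [Real.rpow_sub hS', Real.rpow_one, div_le_iff₀ (Real.rpow_pos_of_pos hS' t)]
    linarith
  calc S = (S ^ (1 - t)) ^ (1 - t)⁻¹ := (Real.rpow_rpow_inv hS ht'.ne').symm
    _ ≤ (C * T ^ (1 - t)) ^ (1 - t)⁻¹ := by gcongr
    _ = C ^ (1 - t)⁻¹ * T := by
        rw [Real.mul_rpow hC (by positivity), Real.rpow_rpow_inv hT ht'.ne']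

theorem sq_mul_pow_le_rpow_mul_rpow {β q l g z : ℝ} {m : ℕ} (hβ : 0 < β) (hq : 0 < q) (hg : 0 ≤ g)
    (hz : 0 ≤ z) (hz1 : z ≤ 1) (hl0 : 0 < l) (hl1 : l < 1)
    (hl : (2 + β) * q * l + (1 - l) = 2 * (2 + β)) (hm : 2 ≤ m)
    (hml : m * q * l + (1 - l) ≤ 2 * m - 2) :
    (g ^ β * g ^ 2) ^ 2 * z ^ (2 * m - 2) ≤
      (|g ^ β * g ^ 2 * z ^ m| ^ q) ^ l * (g * z) ^ (1 - l) := by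
  rcases hz.eq_or_lt with rfl | hz0
  · rw [zero_pow (by omega), mul_zero]
    exact mul_nonneg (Real.rpow_nonneg (Real.rpow_nonneg (abs_nonneg _) _) _)
      (Real.rpow_nonneg (by simp) _)
  have hl1' : 0 < 1 - l := by linarith
  have e1 : g ^ β * g ^ 2 = g ^ (2 + β) := by
    rw [add_comm, ← Nat.cast_ofNat (R := ℝ) (n := 2), Real.rpow_add_natCast' hg (by positivity)]
  have e2 : (g ^ (2 + β)) ^ 2 = g ^ (2 * (2 + β)) := by
    rw [← Real.rpow_mul_natCast hg]
    congr 1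
    push_cast
    ring
  have hmz : (((2 * m - 2 : ℕ) : ℝ)) = 2 * m - 2 := by
    rw [Nat.cast_sub (by omega)]
    push_cast
    ring
  have hgs : 0 ≤ g ^ (2 + β) := Real.rpow_nonneg hg _
  rw [e1, abs_of_nonneg (by positivity), e2, Real.mul_rpow hgs (by positivity),
    Real.mul_rpow (by positivity) (by positivity), Real.mul_rpow hg hz, ← Real.rpow_mul hg,
    ← Real.rpow_mul hg, ← Real.rpow_natCast z m, ← Real.rpow_mul hz, ← Real.rpow_mul hz,
    ← Real.rpow_natCast, hmz]
  calc g ^ (2 * (2 + β)) * z ^ (2 * (m : ℝ) - 2)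
      ≤ g ^ (2 * (2 + β)) * z ^ (m * q * l + (1 - l)) := by
        gcongr ?_ * ?_
        exact Real.rpow_le_rpow_of_exponent_ge hz0 hz1 hml
    _ = _ := by
        rw [← hl, Real.rpow_add_of_nonneg hg (by positivity) hl1'.le,
          Real.rpow_add_of_nonneg hz (by positivity) hl1'.le]
        ring

variable {n : ℕ}

local notation "E" => EuclideanSpace ℝ (Fin n)

theorem exists_cutoff : ∃ (ζ : E → ℝ) (L : ℝ), 0 ≤ L ∧ ContDiff ℝ 2 ζ ∧ (∀ x, 0 ≤ ζ x) ∧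
    (∀ x, ζ x ≤ 1) ∧ (∀ x ∈ ball (0 : E) (1 / 2), ζ x = 1) ∧ tsupport ζ ⊆ closedBall 0 (3 / 4) ∧
    (∀ x, ‖gradient ζ x‖ ≤ L) ∧ ∀ x, |lap ζ x| ≤ L := by
  let ζ : ContDiffBump (0 : E) := ⟨1 / 2, 3 / 4, by norm_num, by norm_num⟩
  have hs : ContDiff ℝ 2 ζ := ζ.contDiff
  have hc : HasCompactSupport ζ := ζ.hasCompactSupport
  obtain ⟨L₁, hL₁⟩ := (hs.continuous_fderiv two_ne_zero).bounded_above_of_compact_support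
    (hc.fderiv ℝ)
  have h1 : ∀ v : E, ContDiff ℝ 1 (fun x => fderiv ℝ ζ x v) := fun v =>
    (hs.fderiv_right (by norm_num)).clm_apply contDiff_const
  have h2 : Continuous (lap ζ) := continuous_finsetSum _ fun i _ =>
    ((h1 _).continuous_fderiv one_ne_zero).clm_apply continuous_const
  have h4 : ∀ v : E, tsupport (fun x => fderiv ℝ (fun y => fderiv ℝ ζ y v) x v) ⊆ tsupport ζ :=
    fun v => (tsupport_fderiv_apply_subset ℝ v).trans (tsupport_fderiv_apply_subset ℝ v)
  have h3 : HasCompactSupport (lap ζ) := by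
    refine hc.mono' fun x hx => ?_
    by_contra hxs
    refine hx (Finset.sum_eq_zero fun i _ => ?_)
    exact image_eq_zero_of_notMem_tsupport
      (f := fun x => fderiv ℝ (fun y => fderiv ℝ ζ y _) x _) fun h => hxs (h4 _ h)
  obtain ⟨L₂, hL₂⟩ := h2.bounded_above_of_compact_support h3
  refine ⟨ζ, max L₁ L₂, ?_, hs, fun x => ζ.nonneg, fun x => ζ.le_one, fun x hx => ?_, ?_,
    fun x => ?_, fun x => (hL₂ x).trans (le_max_right _ _)⟩
  · exact ((norm_nonneg _).trans (hL₁ 0)).trans (le_max_left _ _)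
  · exact ζ.one_of_mem_closedBall (ball_subset_closedBall hx)
  · rw [ζ.tsupport_eq]
  · rw [norm_gradient_eq_norm_fderiv]
    exact (hL₁ x).trans (le_max_left _ _)

theorem norm_gradient_pow_sq {ζ : E → ℝ} {x : E} (hζ : DifferentiableAt ℝ ζ x) (m : ℕ) :
    ‖gradient (fun y => ζ y ^ m) x‖ ^ 2 = m ^ 2 * ζ x ^ (2 * m - 2) * ‖gradient ζ x‖ ^ 2 := by
  rw [norm_gradient_eq_norm_fderiv, norm_gradient_eq_norm_fderiv, (hζ.hasFDerivAt.pow m).fderiv]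
  rw [norm_smul, mul_pow, nsmul_eq_mul, norm_mul, norm_pow, mul_pow, ← pow_mul, Real.norm_natCast,
    Real.norm_eq_abs, mul_comm (m - 1) 2, pow_mul, sq_abs, ← pow_mul, Nat.mul_sub]

end Interpolation

section Estimate

variable {n : ℕ}

local notation "E" => EuclideanSpace ℝ (Fin n)

theorem integral_sq_mul_pow_le {β q l : ℝ} {m : ℕ} {g ζ : E → ℝ} {r : ℝ} (hβ : 0 < β) (hq : 0 < q)
    (hl0 : 0 < l) (hl1 : l < 1) (hl : (2 + β) * q * l + (1 - l) = 2 * (2 + β)) (hm : 2 ≤ m)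
    (hml : m * q * l + (1 - l) ≤ 2 * m - 2) (hr : r < 1) (hg : ContinuousOn g (ball 0 1))
    (hg0 : ∀ x ∈ ball (0 : E) 1, 0 ≤ g x) (hζ : Continuous ζ) (hζ0 : ∀ x, 0 ≤ ζ x)
    (hζ1 : ∀ x, ζ x ≤ 1) (hs : tsupport ζ ⊆ closedBall 0 r) :
    Integrable (fun x => |g x ^ β * g x ^ 2 * ζ x ^ m| ^ q) ∧
    Integrable (fun x => (g x ^ β * g x ^ 2) ^ 2 * ζ x ^ (2 * m - 2)) ∧
    ∫ x, (g x ^ β * g x ^ 2) ^ 2 * ζ x ^ (2 * m - 2) ≤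
      (∫ x, |g x ^ β * g x ^ 2 * ζ x ^ m| ^ q) ^ l * (∫ x, g x * ζ x) ^ (1 - l) := by
  have hc : HasCompactSupport ζ := HasCompactSupport.of_support_subset_isCompact
    (isCompact_closedBall 0 r) ((subset_tsupport _).trans hs)
  have hsΩ := hs.trans (closedBall_subset_ball hr)
  have cgβ : ContinuousOn (fun x => g x ^ β * g x ^ 2) (ball 0 1) :=
    (hg.rpow_const fun _ _ => Or.inr hβ.le).mul (hg.pow 2)
  have i1 : Integrable (fun x => |g x ^ β * g x ^ 2 * ζ x ^ m| ^ q) := by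
    refine integrable_of_continuousOn_of_eq_zero hc hsΩ
      (((cgβ.mul (hζ.continuousOn.pow m)).abs).rpow_const fun _ _ => Or.inr hq.le) fun x hx => ?_
    rw [image_eq_zero_of_notMem_tsupport hx, zero_pow (by omega), mul_zero, abs_zero,
      Real.zero_rpow hq.ne']
  have i2 : Integrable (fun x => (g x ^ β * g x ^ 2) ^ 2 * ζ x ^ (2 * m - 2)) := by
    refine integrable_of_continuousOn_of_eq_zero hc hsΩ
      ((cgβ.pow 2).mul (hζ.continuousOn.pow _)) fun x hx => ?_
    rw [image_eq_zero_of_notMem_tsupport hx, zero_pow (by omega), mul_zero]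
  have hgζ : ∀ x, 0 ≤ g x * ζ x := fun x => by
    by_cases hx : x ∈ tsupport ζ
    · exact mul_nonneg (hg0 x (hsΩ hx)) (hζ0 x)
    · rw [image_eq_zero_of_notMem_tsupport hx, mul_zero]
  obtain ⟨i3, h3⟩ := integral_rpow_mul_rpow_le (fun x => Real.rpow_nonneg (abs_nonneg _) q) hgζ i1
    (hg.integrable_mul_of_tsupport_subset isOpen_ball hζ hc hsΩ) hl0 hl1
  refine ⟨i1, i2, (integral_mono i2 i3 fun x => ?_).trans h3⟩
  by_cases hx : x ∈ tsupport ζ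
  · exact sq_mul_pow_le_rpow_mul_rpow hβ hq (hg0 x (hsΩ hx)) (hζ0 x) (hζ1 x) hl0 hl1 hl hm hml
  · simp only [image_eq_zero_of_notMem_tsupport hx]
    rw [zero_pow (by omega), mul_zero]
    exact mul_nonneg (Real.rpow_nonneg (Real.rpow_nonneg (abs_nonneg _) _) _)
      (Real.rpow_nonneg (by simp) _)

/-- The interior estimate at the exponent `(2 + β) q`, where `q` is an exponent admissible in the
Sobolev inequality for `W^{1,2}`. -/
theorem exists_interior_estimate (hn : 1 ≤ n) {θ K β q : ℝ} (hθ : 0 < θ) (hK : 0 ≤ K)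
    (hβ : 0 < β) (hβ' : β < Real.sqrt (1 + θ) - 1) (hq : 2 < q)
    (hnq : n ≤ 2 ∨ (2 : ℝ)⁻¹ - (n : ℝ)⁻¹ ≤ q⁻¹) :
    ∃ C : ℝ, 0 ≤ C ∧ ∀ (f f' f'' : ℝ → ℝ) (u : E → ℝ), C2On01 f f' f'' →
      (∀ t ∈ Ico (0 : ℝ) 1, 0 ≤ f t) →
      (∀ t ∈ Ico (0 : ℝ) 1, (1 + θ) * f' t ^ 2 - K ≤ f'' t * f t) →
      ContDiffOn ℝ 2 u (closedBall 0 1) → MapsTo u (closedBall 0 1) (Ico 0 1) →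
      (∀ x ∈ ball (0 : E) 1, -lap u x = f (u x)) → StableSol f' u (ball 0 1) →
      ∫ x in ball (0 : E) (1 / 2), f (u x) ^ ((2 + β) * q) ≤
        (C * ∫ x in ball (0 : E) 1, u x) ^ ((2 + β) * q) := by
  obtain ⟨C₁, hC₁, hen⟩ := exists_energy_bound (n := n) hθ hK hβ hβ'
  obtain ⟨C₂, hC₂, hsob⟩ := exists_sobolev_inequality hn hq hnq
  obtain ⟨ζ, L, hL, hζ, hζ0, hζ1, hζe, hs, hζL, hζΔ⟩ := exists_cutoff (n := n)
  have hq0 : 0 < q := by linarith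
  have hsq : 0 < (2 + β) * q - 1 := by nlinarith
  set l : ℝ := (2 * (2 + β) - 1) / ((2 + β) * q - 1) with hl
  have hl0 : 0 < l := div_pos (by linarith) hsq
  have hl1 : l < 1 := by
    rw [hl, div_lt_one hsq]
    nlinarith
  have hle : l * ((2 + β) * q - 1) = 2 * (2 + β) - 1 := div_mul_cancel₀ _ hsq.ne'
  set t : ℝ := q * l / 2 with ht
  have ht1 : t < 1 := by
    have h1 : t * ((2 + β) * q - 1) < 1 * ((2 + β) * q - 1) := by
      rw [ht]
      linear_combination (1 / 2) * hq + (q / 2) * hle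
    exact lt_of_mul_lt_mul_right h1 hsq.le
  have hlt : 1 - l = 2 * (2 + β) * (1 - t) := by
    rw [ht]
    linear_combination hle
  obtain ⟨m, hm⟩ := exists_nat_ge (max 2 ((3 - l) / (2 - q * l)))
  have hm2 : 2 ≤ m := by exact_mod_cast (le_max_left _ _).trans hm
  have hml : m * q * l + (1 - l) ≤ 2 * m - 2 := by
    have h1 := (le_max_right _ _).trans hm
    rw [div_le_iff₀ (by rw [ht] at ht1; linarith)] at h1
    linarith
  set C₃ : ℝ := C₂ * C₁ * (1 + m ^ 2 * L ^ 2) with hC₃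
  have hC₃0 : 0 ≤ C₃ := by positivity
  refine ⟨((2 * C₃) ^ (1 - t)⁻¹) ^ (2 * (2 + β))⁻¹ * (L + 1), by positivity, ?_⟩
  intro f f' f'' u hf hf0 hff hu hI heq hst
  have hB : ball (0 : E) 1 ⊆ closedBall 0 1 := ball_subset_closedBall
  have hu' := hu.mono hB
  have hI' := hI.mono_left hB
  have hc : HasCompactSupport ζ := HasCompactSupport.of_support_subset_isCompact
    (isCompact_closedBall 0 (3 / 4)) ((subset_tsupport _).trans hs)
  have hr : (3 / 4 : ℝ) < 1 := by norm_num
  have hsΩ := hs.trans (closedBall_subset_ball hr)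
  have hη : ContDiff ℝ 1 fun x => ζ x ^ m := (hζ.pow m).of_le (by norm_num)
  have hηs : tsupport (fun x => ζ x ^ m) ⊆ tsupport ζ := closure_mono fun x hx h =>
    hx (by simp only [h]; exact zero_pow (by omega))
  have cf : ContinuousOn f (Ico 0 1) := fun t ht => (hf.1 t ht).continuousWithinAt
  have cfu : ContinuousOn (fun x => f (u x)) (closedBall 0 1) := cf.comp hu.continuousOn hI
  obtain ⟨dX, dY, hE⟩ := hen f f' f'' u _ _ hf hf0 hff hu' hI' heq hst hη hr (hηs.trans hs)
  obtain ⟨iX, iX', hX⟩ := integral_sq_mul_pow_le hβ hq0 hl0 hl1 (by linarith) hm2 hml hr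
    (cfu.mono hB) (fun x hx => hf0 _ (hI' hx)) hζ.continuous hζ0 hζ1 hs
  obtain ⟨iY, iY', hY⟩ := integral_sq_mul_pow_le hβ hq0 hl0 hl1 (by linarith) hm2 hml hr
    hu'.continuousOn (fun x hx => (hI' hx).1) hζ.continuous hζ0 hζ1 hs
  have hsupp : ∀ v : E → ℝ, tsupport (fun x => v x * ζ x ^ m) ⊆ closedBall 0 1 := fun v =>
    have h1 : tsupport (fun x => v x * ζ x ^ m) ⊆ tsupport fun x => ζ x ^ m :=
      closure_mono fun x hx h => hx (mul_eq_zero_of_right _ h)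
    ((h1.trans hηs).trans hsΩ).trans hB
  have sX := hsob _ dX (hsupp _)
  have sY := hsob _ dY (hsupp _)
  have iu : IntegrableOn u (ball 0 1) :=
    (hu.continuousOn.integrableOn_compact (isCompact_closedBall 0 1)).mono_set hB
  set JX := ∫ x, |f (u x) ^ β * f (u x) ^ 2 * ζ x ^ m| ^ q with hJX
  set JY := ∫ x, |u x ^ β * u x ^ 2 * ζ x ^ m| ^ q with hJY
  set MX := ∫ x, f (u x) * ζ x with hMX
  set MY := ∫ x, u x * ζ x with hMY
  set U := ∫ x in ball (0 : E) 1, u x with hU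
  have hJX0 : 0 ≤ JX := integral_nonneg fun x => Real.rpow_nonneg (abs_nonneg _) _
  have hJY0 : 0 ≤ JY := integral_nonneg fun x => Real.rpow_nonneg (abs_nonneg _) _
  have hmass : ∀ v : E → ℝ, (∀ x ∈ ball (0 : E) 1, 0 ≤ v x) → 0 ≤ ∫ x, v x * ζ x := by
    refine fun v hv => integral_nonneg fun x => ?_
    by_cases hx : x ∈ tsupport ζ
    · exact mul_nonneg (hv x (hsΩ hx)) (hζ0 x)
    · simp only [image_eq_zero_of_notMem_tsupport hx, mul_zero, Pi.zero_apply, le_refl]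
  have hMX0 : 0 ≤ MX := hmass _ fun x hx => hf0 _ (hI' hx)
  have hMY0 : 0 ≤ MY := hmass _ fun x hx => (hI' hx).1
  have hU0 : 0 ≤ U := setIntegral_nonneg isOpen_ball.measurableSet fun x hx => (hI' hx).1
  have hbound : ∀ (φ : E → ℝ) (k : ℝ), tsupport φ ⊆ tsupport ζ → Integrable (fun x => u x * φ x) →
      (∀ x, φ x ≤ k) → ∫ x, u x * φ x ≤ k * U := by
    intro φ k hφ hi hk
    rw [← setIntegral_eq_integral_of_forall_compl_eq_zero (s := ball (0 : E) 1) fun x hx => by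
        rw [image_eq_zero_of_notMem_tsupport fun h => hx (hsΩ (hφ h)), mul_zero],
      hU, ← integral_const_mul]
    refine setIntegral_mono_on hi.integrableOn (iu.const_mul k) isOpen_ball.measurableSet
      fun x hx => ?_
    rw [mul_comm]
    exact mul_le_mul_of_nonneg_right (hk x) (hI' hx).1
  have hMYU : MY ≤ 1 * U := hbound ζ 1 le_rfl (hu'.continuousOn.integrable_mul_of_tsupport_subset
    isOpen_ball hζ.continuous hc hsΩ) hζ1
  have hlapc : Continuous fun x => -lap ζ x := by
    refine (continuous_finsetSum _ fun i _ => ?_).neg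
    have h1 : ContDiff ℝ 1 (fun x => fderiv ℝ ζ x (EuclideanSpace.single i 1)) :=
      (hζ.fderiv_right (by norm_num)).clm_apply contDiff_const
    exact (h1.continuous_fderiv one_ne_zero).clm_apply continuous_const
  have hlaps : tsupport (fun x => -lap ζ x) ⊆ tsupport ζ := by
    refine closure_minimal (fun x hx => ?_) (isClosed_tsupport ζ)
    by_contra hxs
    refine hx (neg_eq_zero.2 (Finset.sum_eq_zero fun i _ => ?_))
    exact image_eq_zero_of_notMem_tsupport
      (f := fun x => fderiv ℝ (fun y => fderiv ℝ ζ y _) x _) fun h => hxs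
        (((tsupport_fderiv_apply_subset ℝ _).trans (tsupport_fderiv_apply_subset ℝ _)) h)
  have hMXU : MX ≤ L * U := by
    have h1 : MX = ∫ x, -lap u x * ζ x := by
      refine integral_congr_ae (Eventually.of_forall fun x => ?_)
      by_cases hx : x ∈ tsupport ζ
      · simp only [heq x (hsΩ hx)]
      · simp only [image_eq_zero_of_notMem_tsupport hx, mul_zero]
    rw [h1, integral_neg_lap_mul_eq isOpen_ball hu' hζ hc hsΩ]
    exact hbound _ L hlaps (hu'.continuousOn.integrable_mul_of_tsupport_subset isOpen_ball hlapc
      (hc.mono' ((subset_tsupport _).trans hlaps)) (hlaps.trans hsΩ))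
      fun x => (neg_le_abs _).trans (hζΔ x)
  have hEB : ∫ x, ((f (u x) ^ β * f (u x) ^ 2) ^ 2 + (u x ^ β * u x ^ 2) ^ 2) *
        ((ζ x ^ m) ^ 2 + ‖gradient (fun x => ζ x ^ m) x‖ ^ 2) ≤
      (1 + m ^ 2 * L ^ 2) * (JX ^ l * MX ^ (1 - l) + JY ^ l * MY ^ (1 - l)) := by
    have h1 : ∫ x, ((f (u x) ^ β * f (u x) ^ 2) ^ 2 + (u x ^ β * u x ^ 2) ^ 2) *
          ((ζ x ^ m) ^ 2 + ‖gradient (fun x => ζ x ^ m) x‖ ^ 2) ≤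
        ∫ x, (1 + m ^ 2 * L ^ 2) * ((f (u x) ^ β * f (u x) ^ 2) ^ 2 * ζ x ^ (2 * m - 2) +
          (u x ^ β * u x ^ 2) ^ 2 * ζ x ^ (2 * m - 2)) := by
      refine integral_mono_of_nonneg (Eventually.of_forall fun x => by positivity)
        ((iX'.add iY').const_mul _) (Eventually.of_forall fun x => ?_)
      beta_reduce
      rw [norm_gradient_pow_sq (hζ.differentiable two_ne_zero x), ← add_mul, mul_left_comm]
      gcongr
      have h2 : (ζ x ^ m) ^ 2 ≤ ζ x ^ (2 * m - 2) := by
        rw [← pow_mul]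
        exact pow_le_pow_of_le_one (hζ0 x) (hζ1 x) (by omega)
      have h3 : (m : ℝ) ^ 2 * ζ x ^ (2 * m - 2) * ‖gradient ζ x‖ ^ 2 ≤
          m ^ 2 * ζ x ^ (2 * m - 2) * L ^ 2 := by
        have := hζ0 x
        gcongr
        exact hζL x
      linarith
    refine h1.trans ?_
    rw [integral_const_mul, integral_add iX' iY']
    gcongr
  set S := JX ^ (2 / q) + JY ^ (2 / q) with hS
  have hJl : ∀ J : ℝ, 0 ≤ J → J ^ l = (J ^ (2 / q)) ^ t := fun J hJ => by
    rw [← Real.rpow_mul hJ, ht]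
    congr 1
    field_simp
  have hMl : ∀ M : ℝ, 0 ≤ M → M ^ (1 - l) = (M ^ (2 * (2 + β))) ^ (1 - t) := fun M hM => by
    rw [← Real.rpow_mul hM, hlt]
  set N := (L + 1) * U with hN
  have hN0 : 0 ≤ N := by positivity
  have ht0 : 0 < t := by positivity
  have ht1' : 0 < 1 - t := by linarith
  have hS0 : 0 ≤ S := by positivity
  have hterm : ∀ J M : ℝ, 0 ≤ J → 0 ≤ M → J ^ (2 / q) ≤ S → M ≤ N →
      J ^ l * M ^ (1 - l) ≤ S ^ t * (N ^ (2 * (2 + β))) ^ (1 - t) := by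
    intro J M hJ hM hJS hMN
    rw [hJl J hJ, hMl M hM]
    gcongr
  have hfin : S ≤ 2 * C₃ * (S ^ t * (N ^ (2 * (2 + β))) ^ (1 - t)) := by
    have h1 := hterm JX MX hJX0 hMX0 (le_add_of_nonneg_right (by positivity)) (by linarith)
    have h2 := hterm JY MY hJY0 hMY0 (le_add_of_nonneg_left (by positivity))
      (by linarith [mul_nonneg hL hU0])
    calc S ≤ C₂ * (C₁ * ((1 + m ^ 2 * L ^ 2) *
          (JX ^ l * MX ^ (1 - l) + JY ^ l * MY ^ (1 - l)))) := by
          have h3 := mul_le_mul_of_nonneg_left hEB hC₁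
          have h4 := mul_le_mul_of_nonneg_left (hE.trans h3) hC₂
          linarith
      _ = C₃ * (JX ^ l * MX ^ (1 - l) + JY ^ l * MY ^ (1 - l)) := by rw [hC₃]; ring
      _ ≤ C₃ * (S ^ t * (N ^ (2 * (2 + β))) ^ (1 - t) +
          S ^ t * (N ^ (2 * (2 + β))) ^ (1 - t)) := by gcongr
      _ = _ := by ring
  have hSN := le_rpow_mul_of_le_mul_rpow_mul_rpow (by positivity) hS0 (by positivity) ht1 hfin
  have hJS : JX ≤ S ^ (q / 2) := by
    calc JX = (JX ^ (2 / q)) ^ (q / 2) := by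
          rw [← Real.rpow_mul hJX0, show 2 / q * (q / 2) = 1 by field_simp, Real.rpow_one]
      _ ≤ S ^ (q / 2) := by
          gcongr
          exact le_add_of_nonneg_right (by positivity)
  have hhalf : ball (0 : E) (1 / 2) ⊆ ball 0 1 := ball_subset_ball (by norm_num)
  calc ∫ x in ball (0 : E) (1 / 2), f (u x) ^ ((2 + β) * q)
      = ∫ x in ball (0 : E) (1 / 2), |f (u x) ^ β * f (u x) ^ 2 * ζ x ^ m| ^ q := by
        refine setIntegral_congr_fun isOpen_ball.measurableSet fun x hx => ?_
        have h0 := hf0 _ (hI' (hhalf hx))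
        simp only [hζe x hx, one_pow, mul_one]
        rw [abs_of_nonneg (mul_nonneg (Real.rpow_nonneg h0 _) (sq_nonneg _)), Real.rpow_mul h0,
          add_comm, ← Nat.cast_ofNat (R := ℝ) (n := 2), Real.rpow_add_natCast' h0 (by positivity)]
    _ ≤ JX := setIntegral_le_integral iX
        (Eventually.of_forall fun x => Real.rpow_nonneg (abs_nonneg _) _)
    _ ≤ ((2 * C₃) ^ (1 - t)⁻¹ * N ^ (2 * (2 + β))) ^ (q / 2) := hJS.trans (by gcongr)
    _ = (((2 * C₃) ^ (1 - t)⁻¹) ^ (2 * (2 + β))⁻¹ * (L + 1) * U) ^ ((2 + β) * q) := by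
        have hA : 0 ≤ (2 * C₃) ^ (1 - t)⁻¹ := by positivity
        rw [mul_assoc, ← hN, Real.mul_rpow hA (by positivity), Real.mul_rpow (by positivity) hN0,
          ← Real.rpow_mul hN0, ← Real.rpow_mul hA]
        congr 2
        · field_simp
        · ring

end Estimate

theorem setIntegral_rpow_le_of_exponent_lt {α : Type*} [MeasurableSpace α] {μ : Measure α}
    {s : Set α} (hs : MeasurableSet s) (hμ : μ s ≠ ⊤) {g : α → ℝ} (hg : ∀ x ∈ s, 0 ≤ g x) {p r : ℝ}
    (hp : 0 < p) (hpr : p < r) (hi : IntegrableOn (fun x => |g x| ^ r) s μ) :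
    ∫ x in s, g x ^ p ∂μ ≤ (∫ x in s, g x ^ r ∂μ) ^ (p / r) * μ.real s ^ (1 - p / r) := by
  have hr : 0 < r := hp.trans hpr
  have h := (integral_rpow_mul_rpow_le (b := fun _ => (1 : ℝ))
    (fun x => Real.rpow_nonneg (abs_nonneg (g x)) r) (fun _ => zero_le_one) hi
    (integrableOn_const hμ) (div_pos hp hr) ((div_lt_one hr).2 hpr)).2
  have h1 : ∫ x in s, |g x| ^ r ∂μ = ∫ x in s, g x ^ r ∂μ :=
    setIntegral_congr_fun hs fun x hx => by simp only [abs_of_nonneg (hg x hx)]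
  have h2 : ∫ x in s, (|g x| ^ r) ^ (p / r) * (1 : ℝ) ^ (1 - p / r) ∂μ = ∫ x in s, g x ^ p ∂μ :=
    setIntegral_congr_fun hs fun x hx => by
      simp only [abs_of_nonneg (hg x hx), Real.one_rpow, mul_one]
      rw [← Real.rpow_mul (hg x hx), mul_div_cancel₀ _ hr.ne']
  rwa [h1, h2, setIntegral_const, smul_eq_mul, mul_one] at h

/-- Interior `L^p̄` estimate for `f(u)` (Proposition 1.4): for stable solutions
in `B₁` with `f ≥ 0` satisfying `f''f ≥ (1+θ)f'² - K`, and `β ∈ (0, √(1+θ) - 1)`, with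
`p̄ = (2+β)·2n/(n-2)` for `n ≥ 3` (`p̄ ≥ 1` arbitrary for `n ≤ 2`), one has
`‖f(u)‖_{L^p̄(B_{1/2})} ≤ C ‖u‖_{L¹(B₁)}` with `C = C(n, θ, K, β, p̄)`. -/
theorem stmt3 (n : ℕ) (hn : 1 ≤ n) (θ K β p : ℝ) (hθ : 0 < θ) (hK : 0 ≤ K)
    (hβ : β ∈ Ioo 0 (Real.sqrt (1 + θ) - 1))
    (hp : (3 ≤ n ∧ p = (2 + β) * (2 * (n:ℝ)) / ((n:ℝ) - 2)) ∨ (n ≤ 2 ∧ 1 ≤ p)) :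
    ∃ C : ℝ, 0 < C ∧
      ∀ (f f' f'' : ℝ → ℝ) (u : EuclideanSpace ℝ (Fin n) → ℝ),
        C2On01 f f' f'' →
        (∀ t ∈ Ico (0:ℝ) 1, 0 ≤ f t) →
        (∀ t ∈ Ico (0:ℝ) 1, (1 + θ) * f' t ^ 2 - K ≤ f'' t * f t) →
        ContDiffOn ℝ 2 u (closure (ball (0:EuclideanSpace ℝ (Fin n)) 1)) →
        (∀ x ∈ closure (ball (0:EuclideanSpace ℝ (Fin n)) 1), 0 ≤ u x ∧ u x < 1) →
        (∀ x ∈ ball (0:EuclideanSpace ℝ (Fin n)) 1, -lap u x = f (u x)) →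
        StableSol f' u (ball 0 1) →
        (∫ x in ball (0:EuclideanSpace ℝ (Fin n)) (1/2), f (u x) ^ p) ^ (1/p) ≤
          C * ∫ y in ball (0:EuclideanSpace ℝ (Fin n)) 1, u y := by
  obtain ⟨hβ0, hβ1⟩ := hβ
  rw [closure_ball _ one_ne_zero]
  rcases hp with ⟨hn3, rfl⟩ | ⟨hn2, hp1⟩
  · have hn3' : (3 : ℝ) ≤ n := by exact_mod_cast hn3
    have hd : (0 : ℝ) < n - 2 := by linarith
    have hq : (2 : ℝ) < 2 * n / (n - 2) := by
      rw [lt_div_iff₀ hd]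
      linarith
    obtain ⟨C, hC, h⟩ := exists_interior_estimate hn hθ hK hβ0 hβ1 hq <| Or.inr <| le_of_eq <| by
      have : (n : ℝ) ≠ 0 := by positivity
      field_simp
    refine ⟨C + 1, by linarith, fun f f' f'' u hf hf0 hff hu hI heq hst => ?_⟩
    have hU : 0 ≤ ∫ y in ball (0:EuclideanSpace ℝ (Fin n)) 1, u y :=
      setIntegral_nonneg isOpen_ball.measurableSet fun x hx => (hI x (ball_subset_closedBall hx)).1
    have h1 := h f f' f'' u hf hf0 hff hu hI heq hst
    rw [mul_div_assoc, one_div (_ * _)]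
    have hP : 0 < (2 + β) * (2 * (n : ℝ) / (n - 2)) := mul_pos (by linarith) (by linarith)
    refine (Real.rpow_inv_le_iff_of_pos ?_ (mul_nonneg (by linarith) hU) hP).2 (h1.trans ?_)
    · exact setIntegral_nonneg isOpen_ball.measurableSet fun x hx => Real.rpow_nonneg
        (hf0 _ (hI x (ball_subset_closedBall (ball_subset_ball (by norm_num) hx)))) _
    · gcongr
      linarith
  · set q := max 3 p with hq
    have hq3 : 3 ≤ q := le_max_left _ _
    have hqp : p ≤ q := le_max_right _ _
    have hp0 : 0 < p := by linarith
    set r := (2 + β) * q with hr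
    have hpr : p < r := by nlinarith
    have hr0 : 0 < r := hp0.trans hpr
    obtain ⟨C, hC, h⟩ := exists_interior_estimate hn hθ hK hβ0 hβ1 (q := q) (by linarith)
      (Or.inl hn2)
    set V := volume.real (ball (0 : EuclideanSpace ℝ (Fin n)) (1 / 2))
    refine ⟨(C + 1) * ((V ^ (1 - p / r)) ^ (1 / p) + 1), by positivity,
      fun f f' f'' u hf hf0 hff hu hI heq hst => ?_⟩
    have hU : 0 ≤ ∫ y in ball (0:EuclideanSpace ℝ (Fin n)) 1, u y :=
      setIntegral_nonneg isOpen_ball.measurableSet fun x hx => (hI x (ball_subset_closedBall hx)).1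
    have h1 := h f f' f'' u hf hf0 hff hu hI heq hst
    have hsub : ball (0 : EuclideanSpace ℝ (Fin n)) (1 / 2) ⊆ closedBall 0 1 :=
      ball_subset_closedBall.trans (closedBall_subset_closedBall (by norm_num))
    have hfu : ∀ x ∈ ball (0 : EuclideanSpace ℝ (Fin n)) (1 / 2), 0 ≤ f (u x) := fun x hx =>
      hf0 _ (hI x (hsub hx))
    have cfu : ContinuousOn (fun x => f (u x)) (closedBall 0 1) :=
      ContinuousOn.comp (fun t ht => (hf.1 t ht).continuousWithinAt) hu.continuousOn hI
    have h2 := setIntegral_rpow_le_of_exponent_lt (μ := volume) isOpen_ball.measurableSet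
      measure_ball_lt_top.ne hfu hp0 hpr
      (((cfu.abs.rpow_const fun _ _ => Or.inr hr0.le).integrableOn_compact
        (isCompact_closedBall 0 1)).mono_set hsub)
    have hI0 : ∀ s : ℝ, 0 ≤ ∫ x in ball (0:EuclideanSpace ℝ (Fin n)) (1/2), f (u x) ^ s := fun s =>
      setIntegral_nonneg isOpen_ball.measurableSet fun x hx => Real.rpow_nonneg (hfu x hx) _
    set U := ∫ y in ball (0:EuclideanSpace ℝ (Fin n)) 1, u y
    have hV : 0 ≤ V := measureReal_nonneg
    have hCU : 0 ≤ C * U := by positivity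
    calc (∫ x in ball (0:EuclideanSpace ℝ (Fin n)) (1/2), f (u x) ^ p) ^ (1/p)
        ≤ (((C * U) ^ r) ^ (p / r) * V ^ (1 - p / r)) ^ (1 / p) := by
          refine Real.rpow_le_rpow (hI0 p) (h2.trans ?_) (by positivity)
          gcongr
          exact hI0 r
      _ = C * U * (V ^ (1 - p / r)) ^ (1 / p) := by
          rw [Real.mul_rpow (by positivity) (by positivity), ← Real.rpow_mul hCU,
            ← Real.rpow_mul hCU, show r * (p / r) * (1 / p) = 1 by field_simp, Real.rpow_one]
      _ ≤ (C + 1) * U * ((V ^ (1 - p / r)) ^ (1 / p) + 1) := by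
          gcongr <;> linarith
      _ = _ := by ring
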